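/- arXiv:1709.05287 — 5 statements merged into one kernel-verified Lean document; each statement's English description precedes it below -/
import Mathlib

section
/- Let μ, ν ∈ P_1(ℝ) and let ψ̃ be the concave hull (the smallest concave function larger than) of the function [0,1] ∋ q ↦ ∫_q^1 (F_μ^{-1}(p) − F_ν^{-1}(p)) dp. Then there exists a probability measure ν_{P̄(μ)} on ℝ such that for all q ∈ [0,1], ∫_q^1 F_{ν_{P̄(μ)}}^{-1}(p) dp = ψ̃(q) + ∫_q^1 F_ν^{-1}(p) dp. Moreover μ ≤cx ν_{P̄(μ)}, and for each ρ > 1 such that μ, ν ∈ P_ρ(ℝ), ν_{P̄(μ)} is the unique probability measure η with μ ≤cx η minimizing W_ρ(ν,η). -/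
open MeasureTheory ProbabilityTheory Set
open scoped ENNReal

noncomputable section

/-- `μ ≤cx ν`: convex order between measures on a normed space. -/
def ConvexOrder {E : Type*} [NormedAddCommGroup E] [NormedSpace ℝ E] [MeasurableSpace E]
    (μ ν : Measure E) : Prop :=
  (∀ φ : E → ℝ, ConvexOn ℝ univ φ → (∀ x, 0 ≤ φ x) →
      ∫⁻ x, ENNReal.ofReal (φ x) ∂μ ≤ ∫⁻ x, ENNReal.ofReal (φ x) ∂ν) ∧
  (∀ φ : E → ℝ, ConvexOn ℝ univ φ → Integrable φ (μ + ν) →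
      ∫ x, φ x ∂μ ≤ ∫ x, φ x ∂ν)

/-- `Wp ρ μ ν` is the ρ-th power `W_ρ(μ,ν)^ρ` of the ρ-Wasserstein distance. -/
def Wp {E : Type*} [NormedAddCommGroup E] [MeasurableSpace E]
    (ρ : ℝ) (μ ν : Measure E) : ℝ≥0∞ :=
  ⨅ (π : Measure (E × E)) (_ : π.map Prod.fst = μ) (_ : π.map Prod.snd = ν),
    ∫⁻ p, ENNReal.ofReal (‖p.1 - p.2‖ ^ ρ) ∂π

/-- The quantile function `F_η^{-1}(p) = inf {x : F_η(x) ≥ p}` of a measure on `ℝ`. -/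
def quantileFn (η : Measure ℝ) (p : ℝ) : ℝ :=
  sInf {x : ℝ | p ≤ (η (Iic x)).toReal}


/-- Lebesgue measure on the open unit interval. -/
abbrev I01 : Measure ℝ := volume.restrict (Ioo (0:ℝ) 1)

instance I01_prob : IsProbabilityMeasure I01 := ⟨by simp [I01]⟩

lemma quantile_le_iff (m : Measure ℝ) [IsProbabilityMeasure m] {p x : ℝ} (hp : p ∈ Ioo (0:ℝ) 1) :
    quantileFn m p ≤ x ↔ p ≤ m.real (Iic x) := by
  have hset : {x : ℝ | p ≤ (m (Iic x)).toReal} = {x : ℝ | p ≤ cdf m x} := by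
    ext y; simp [cdf_eq_real, Measure.real]
  unfold quantileFn
  rw [hset, ← cdf_eq_real]
  have hne : {x : ℝ | p ≤ cdf m x}.Nonempty := by
    have := (tendsto_cdf_atTop m).eventually (lt_mem_nhds hp.2)
    obtain ⟨y, hy⟩ := this.exists
    exact ⟨y, hy.le⟩
  have hbdd : BddBelow {x : ℝ | p ≤ cdf m x} := by
    have := (tendsto_cdf_atBot m).eventually (gt_mem_nhds hp.1)
    obtain ⟨y, hy⟩ := this.exists
    refine ⟨y, fun z hz => ?_⟩
    by_contra hlt
    push Not at hlt
    have := monotone_cdf m hlt.le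
    simp only [mem_ofPred_eq] at hz
    linarith
  constructor
  · intro h
    have key : ∀ y, x < y → p ≤ cdf m y := by
      intro y hy
      obtain ⟨z, hz, hzy⟩ := exists_lt_of_csInf_lt hne (lt_of_le_of_lt h hy)
      exact le_trans hz (monotone_cdf m hzy.le)
    have hc : Filter.Tendsto (cdf m) (nhdsWithin x (Ioi x)) (nhds (cdf m x)) :=
      ((cdf m).right_continuous x).tendsto.mono_left (nhdsWithin_mono _ Ioi_subset_Ici_self)
    refine ge_of_tendsto hc ?_
    filter_upwards [self_mem_nhdsWithin] with y hy using key y hy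
  · intro h
    exact csInf_le hbdd h

lemma quantile_mono (m : Measure ℝ) [IsProbabilityMeasure m] :
    MonotoneOn (quantileFn m) (Ioo (0:ℝ) 1) := by
  intro p hp q hq hpq
  rw [quantile_le_iff m hp]
  exact hpq.trans ((quantile_le_iff m hq).1 le_rfl)

lemma mono_aem {f : ℝ → ℝ} (hf : MonotoneOn f (Ioo (0:ℝ) 1)) : AEMeasurable f I01 :=
  aemeasurable_restrict_of_monotoneOn measurableSet_Ioo hf

lemma quantile_aem (m : Measure ℝ) [IsProbabilityMeasure m] : AEMeasurable (quantileFn m) I01 :=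
  mono_aem (quantile_mono m)

lemma I01_Iic {c : ℝ} (_h0 : 0 ≤ c) (h1 : c ≤ 1) : I01 (Iic c) = ENNReal.ofReal c := by
  rw [I01, Measure.restrict_apply measurableSet_Iic]
  apply le_antisymm
  · calc volume (Iic c ∩ Ioo (0:ℝ) 1) ≤ volume (Ioc 0 c) := by
          apply measure_mono
          rintro x ⟨h, h'⟩
          exact ⟨h'.1, h⟩
      _ = _ := by simp
  · calc ENNReal.ofReal c = volume (Ioo 0 c) := by simp
      _ ≤ _ := by
          apply measure_mono
          rintro x ⟨h, h'⟩
          exact ⟨h'.le, h, by linarith⟩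

lemma map_quantile (m : Measure ℝ) [IsProbabilityMeasure m] :
    I01.map (quantileFn m) = m := by
  have := Measure.isProbabilityMeasure_map (quantile_aem m)
  refine Measure.ext_of_Iic _ _ (fun x => ?_)
  rw [Measure.map_apply_of_aemeasurable (quantile_aem m) measurableSet_Iic]
  have h1 : I01 (quantileFn m ⁻¹' Iic x) = I01 (Iic (m.real (Iic x))) := by
    apply measure_congr
    filter_upwards [ae_restrict_mem measurableSet_Ioo] with p hp
    exact propext (quantile_le_iff m hp)
  rw [h1, I01_Iic measureReal_nonneg measureReal_le_one, ofReal_measureReal]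

lemma lintegral_quantile (m : Measure ℝ) [IsProbabilityMeasure m] {f : ℝ → ℝ≥0∞}
    (hf : Measurable f) : ∫⁻ p, f (quantileFn m p) ∂I01 = ∫⁻ x, f x ∂m := by
  conv_rhs => rw [← map_quantile m]
  rw [lintegral_map' hf.aemeasurable (quantile_aem m)]

lemma integral_quantile (m : Measure ℝ) [IsProbabilityMeasure m] {f : ℝ → ℝ}
    (hf : Measurable f) : ∫ p, f (quantileFn m p) ∂I01 = ∫ x, f x ∂m := by
  conv_rhs => rw [← map_quantile m]
  rw [integral_map (quantile_aem m) hf.aestronglyMeasurable]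

lemma integrable_quantile (m : Measure ℝ) [IsProbabilityMeasure m]
    (hm : Integrable (fun x => x) m) : Integrable (quantileFn m) I01 := by
  have h : Integrable (fun x : ℝ => x) (I01.map (quantileFn m)) := by rwa [map_quantile m]
  rwa [integrable_map_measure (by fun_prop) (quantile_aem m)] at h

lemma ii_eq (f : ℝ → ℝ) {q : ℝ} (hq : q ∈ Icc (0:ℝ) 1) :
    ∫ p in q..(1:ℝ), f p = ∫ p in Ioi q, f p ∂I01 := by
  rw [intervalIntegral.integral_of_le hq.2, integral_Ioc_eq_integral_Ioo, I01,
    Measure.restrict_restrict measurableSet_Ioi]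
  congr 2
  ext x; simp only [mem_inter_iff, mem_Ioo, mem_Ioi]
  constructor
  · rintro ⟨h, h'⟩; exact ⟨h, lt_of_le_of_lt hq.1 h, h'⟩
  · rintro ⟨h, h', h''⟩; exact ⟨h, h''⟩

lemma restrict_Ioi_zero : I01.restrict (Ioi 0) = I01 := by
  rw [I01, Measure.restrict_restrict measurableSet_Ioi]
  congr 1
  ext x; simp only [mem_inter_iff, mem_Ioo, mem_Ioi]; tauto

lemma restrict_Ioi_one : I01.restrict (Ioi 1) = 0 := by
  rw [I01, Measure.restrict_restrict measurableSet_Ioi]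
  have : Ioi (1:ℝ) ∩ Ioo 0 1 = ∅ := by
    ext x; simp only [mem_inter_iff, mem_Ioo, mem_Ioi, mem_empty_iff_false, iff_false]
    rintro ⟨h, h', h''⟩; linarith
  rw [this]; simp

lemma I01_real_Ioi {q : ℝ} (hq : q ∈ Icc (0:ℝ) 1) : I01.real (Ioi q) = 1 - q := by
  have := ii_eq (fun _ => (1:ℝ)) hq
  simpa using this.symm

lemma setIntegral_sub_const {f : ℝ → ℝ} (hf : Integrable f I01) (a : ℝ) {q : ℝ}
    (hq : q ∈ Icc (0:ℝ) 1) :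
    ∫ p in Ioi q, (f p - a) ∂I01 = (∫ p in Ioi q, f p ∂I01) - a * (1 - q) := by
  rw [integral_sub hf.integrableOn (integrable_const _)]
  rw [setIntegral_const, I01_real_Ioi hq, smul_eq_mul, mul_comm]

lemma upper_set {γ : ℝ → ℝ} (hγ : MonotoneOn γ (Ioo (0:ℝ) 1)) (t : ℝ) :
    ∃ q ∈ Icc (0:ℝ) 1, ({p | t < γ p} : Set ℝ) =ᵐ[I01] Ioi q := by
  set A : Set ℝ := {p | p = 1 ∨ (p ∈ Ioo (0:ℝ) 1 ∧ t < γ p)} with hA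
  have hne : A.Nonempty := ⟨1, Or.inl rfl⟩
  have hb : ∀ p ∈ A, 0 ≤ p := by
    rintro p (rfl | h)
    · norm_num
    · exact h.1.1.le
  have hbdd : BddBelow A := ⟨0, hb⟩
  refine ⟨sInf A, ⟨le_csInf hne hb, csInf_le hbdd (Or.inl rfl)⟩, ?_⟩
  have hz : ∀ᵐ p ∂I01, p ≠ sInf A := by
    have : I01 {sInf A} = 0 := by simp
    exact measure_eq_zero_iff_ae_notMem.1 this
  filter_upwards [ae_restrict_mem measurableSet_Ioo, hz] with p hp hpne
  apply propext
  change t < γ p ↔ sInf A < p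
  constructor
  · intro h
    exact lt_of_le_of_ne (csInf_le hbdd (Or.inr ⟨hp, h⟩)) hpne.symm
  · intro h
    obtain ⟨z, hz, hzp⟩ := exists_lt_of_csInf_lt hne h
    rcases hz with rfl | hz
    · exact absurd hp.2 (not_lt.2 hzp.le)
    · exact lt_of_lt_of_le hz.2 (hγ hz.1 hp hzp.le)

lemma hardy {D γ : ℝ → ℝ} (hD : Integrable D I01) (hγ : MonotoneOn γ (Ioo (0:ℝ) 1))
    {M : ℝ} (hM : ∀ p ∈ Ioo (0:ℝ) 1, |γ p| ≤ M)
    (hq : ∀ q ∈ Icc (0:ℝ) 1, 0 ≤ ∫ p in Ioi q, D p ∂I01) (h0 : ∫ p, D p ∂I01 = 0) :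
    0 ≤ ∫ p, γ p * D p ∂I01 := by
  have hγm := mono_aem hγ
  obtain ⟨γ', hγ'm, hγγ'⟩ := hγm
  let J : Measure ℝ := volume.restrict (Ioc (-M) M)
  have hM0 : 0 ≤ M := (abs_nonneg _).trans (hM (1/2) (by norm_num))
  have hset : MeasurableSet {z : ℝ × ℝ | z.2 < γ' z.1} :=
    measurableSet_lt measurable_snd (hγ'm.comp measurable_fst)
  let f : ℝ × ℝ → ℝ := ({z : ℝ × ℝ | z.2 < γ' z.1}).indicator (fun z => D z.1)
  have hf : Integrable f (I01.prod J) := by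
    refine Integrable.indicator ?_ hset
    exact hD.comp_fst J
  have hin : ∀ᵐ p ∂I01, ∫ t, f (p, t) ∂J = (γ p + M) * D p := by
    filter_upwards [hγγ', ae_restrict_mem measurableSet_Ioo] with p hp hpI
    have hb := abs_le.1 (hM p hpI)
    have h1 : ∀ t, f (p, t) = (Iio (γ p)).indicator (fun _ => D p) t := by
      intro t
      simp only [f, indicator, mem_ofPred_eq, mem_Iio, hp]
    simp_rw [h1]
    rw [integral_indicator measurableSet_Iio, setIntegral_const, smul_eq_mul]
    congr 1
    simp only [J]
    rw [measureReal_restrict_apply measurableSet_Iio]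
    have h2 : volume.real (Iio (γ p) ∩ Ioc (-M) M) = volume.real (Ioo (-M) (γ p)) := by
      congr 1
      ext t; simp only [mem_inter_iff, mem_Iio, mem_Ioc, mem_Ioo]
      constructor
      · rintro ⟨a, b, c⟩; exact ⟨b, a⟩
      · rintro ⟨a, b⟩; exact ⟨b, a, by linarith⟩
    rw [h2, Real.volume_real_Ioo_of_le (by linarith)]
    ring
  have hout : ∀ t, 0 ≤ ∫ p, f (p, t) ∂I01 := by
    intro t
    obtain ⟨q, hqI, hqe⟩ := upper_set hγ t
    have : ∫ p, f (p, t) ∂I01 = ∫ p in Ioi q, D p ∂I01 := by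
      rw [← integral_indicator measurableSet_Ioi]
      apply integral_congr_ae
      filter_upwards [hγγ', hqe] with p hp hpq
      have hpq' : (t < γ p) = (q < p) := hpq
      simp only [f, indicator, mem_ofPred_eq, mem_Ioi, ← hp, hpq']
    rw [this]; exact hq q hqI
  have hsw := integral_integral_swap (f := fun p t => f (p, t)) hf
  have hpos : 0 ≤ ∫ p, ∫ t, f (p, t) ∂J ∂I01 := by
    rw [hsw]; exact integral_nonneg hout
  rw [integral_congr_ae hin] at hpos
  have hγD : Integrable (fun p => γ p * D p) I01 := by
    refine hD.bdd_mul (c := M) (mono_aem hγ).aestronglyMeasurable ?_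
    filter_upwards [ae_restrict_mem measurableSet_Ioo] with p hp using hM p hp
  have : ∫ p, (γ p + M) * D p ∂I01 = ∫ p, γ p * D p ∂I01 := by
    simp_rw [add_mul]
    rw [integral_add hγD (hD.const_mul M), integral_const_mul, h0]; simp
  rwa [this] at hpos

lemma convex_subgrad {φ : ℝ → ℝ} (hφ : ConvexOn ℝ univ φ) (x y : ℝ) :
    φ x + derivWithin φ (Ioi x) x * (y - x) ≤ φ y := by
  rcases lt_trichotomy x y with h | rfl | h
  · have h1 := hφ.rightDeriv_le_slope_of_mem_interior (x := x) (y := y) (by simp) (mem_univ _) h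
    rw [slope_def_field, le_div_iff₀ (by linarith)] at h1
    linarith
  · simp
  · have h1 := hφ.slope_le_leftDeriv_of_mem_interior (x := y) (y := x) (mem_univ _) (by simp) h
    have h2 := hφ.leftDeriv_le_rightDeriv_of_mem_interior (x := x) (by simp)
    have h3 := h1.trans h2
    rw [slope_def_field, div_le_iff₀ (by linarith)] at h3
    linarith

lemma lip_integrable {Ω : Type*} [MeasurableSpace Ω] {P : Measure Ω} [IsFiniteMeasure P]
    {φ : ℝ → ℝ} {K : NNReal} (hL : LipschitzWith K φ) {X : Ω → ℝ} (hX : Integrable X P) :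
    Integrable (fun p => φ (X p)) P := by
  refine Integrable.mono' (g := fun p => |φ 0| + K * |X p|) ?_ ?_ ?_
  · exact (integrable_const _).add (hX.abs.const_mul _)
  · exact hL.continuous.comp_aestronglyMeasurable hX.aestronglyMeasurable
  · refine Filter.Eventually.of_forall fun p => ?_
    have := hL.dist_le_mul (X p) 0
    rw [Real.dist_eq, Real.dist_eq, sub_zero] at this
    have h2 := abs_sub_abs_le_abs_sub (φ (X p)) (φ 0)
    rw [Real.norm_eq_abs]
    linarith

lemma lip_order {X Y φ : ℝ → ℝ} (hX : Integrable X I01) (hY : Integrable Y I01)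
    (hXm : MonotoneOn X (Ioo (0:ℝ) 1))
    (hq : ∀ q ∈ Icc (0:ℝ) 1, ∫ p in Ioi q, X p ∂I01 ≤ ∫ p in Ioi q, Y p ∂I01)
    (h0 : ∫ p, X p ∂I01 = ∫ p, Y p ∂I01)
    (hφ : ConvexOn ℝ univ φ) {K : NNReal} (hL : LipschitzWith K φ) :
    ∫ p, φ (X p) ∂I01 ≤ ∫ p, φ (Y p) ∂I01 := by
  let g : ℝ → ℝ := fun x => derivWithin φ (Ioi x) x
  have hgm : Monotone g := by
    have := hφ.monotoneOn_rightDeriv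
    simp only [interior_univ] at this
    exact monotoneOn_univ.1 this
  have hgb : ∀ x, |g x| ≤ K := by
    intro x
    have h1 := convex_subgrad hφ x (x + 1)
    have h2 := convex_subgrad hφ x (x - 1)
    have h3 := hL.dist_le_mul (x + 1) x
    have h4 := hL.dist_le_mul (x - 1) x
    rw [Real.dist_eq, Real.dist_eq] at h3 h4
    simp only [add_sub_cancel_left, sub_sub_cancel_left, abs_neg, abs_one, mul_one] at h1 h2 h3 h4
    have h5 := abs_le.1 h3
    have h6 := abs_le.1 h4
    simp only [g]
    rw [abs_le]
    constructor <;> linarith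
  have hγm : MonotoneOn (fun p => g (X p)) (Ioo (0:ℝ) 1) := fun p hp q hq' h => hgm (hXm hp hq' h)
  have hD : Integrable (fun p => Y p - X p) I01 := hY.sub hX
  have H := hardy hD hγm (M := K) (fun p _ => hgb _)
    (fun q hq' => by
      rw [integral_sub hY.integrableOn hX.integrableOn]; linarith [hq q hq'])
    (by rw [integral_sub hY hX]; linarith)
  have hγD : Integrable (fun p => g (X p) * (Y p - X p)) I01 := by
    refine hD.bdd_mul (c := K) (mono_aem hγm).aestronglyMeasurable ?_
    exact Filter.Eventually.of_forall fun p => hgb _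
  have hφX := lip_integrable hL hX
  have hφY := lip_integrable hL hY
  have := integral_mono (hφX.add hγD) hφY (fun p => convex_subgrad hφ (X p) (Y p))
  have h8 : ∫ p, ((fun p => φ (X p)) + fun p => g (X p) * (Y p - X p)) p ∂I01 =
      ∫ p, φ (X p) ∂I01 + ∫ p, g (X p) * (Y p - X p) ∂I01 := integral_add hφX hγD
  rw [h8] at this
  linarith

/-- A nonnegative convex function is an increasing limit of nonnegative Lipschitz convex ones. -/
lemma convex_approx {φ : ℝ → ℝ} (hφ : ConvexOn ℝ univ φ) (hpos : ∀ x, 0 ≤ φ x) :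
    ∃ f : ℕ → ℝ → ℝ, (∀ n, ConvexOn ℝ univ (f n)) ∧ (∀ n, ∃ K : NNReal, LipschitzWith K (f n)) ∧
      (∀ n x, 0 ≤ f n x) ∧ (∀ x, Monotone fun n => f n x) ∧
      (∀ x, ⨆ n, ENNReal.ofReal (f n x) = ENNReal.ofReal (φ x)) := by
  have hcont : Continuous φ := by
    have := hφ.continuousOn_interior
    rw [interior_univ] at this
    exact continuousOn_univ.1 this
  obtain ⟨l, c, hle, hsup⟩ := hφ.real_univ_sSup_of_nat_affine_eq hcont.lowerSemicontinuous
  let f : ℕ → ℝ → ℝ := fun n => Nat.rec (fun _ => 0) (fun n g x => max (g x) (l n x + c n)) n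
  have f0 : f 0 = fun _ => 0 := rfl
  have fs : ∀ n, f (n+1) = fun x => max (f n x) (l n x + c n) := fun n => rfl
  have hmono : ∀ x, Monotone fun n => f n x := fun x =>
    monotone_nat_of_le_succ fun n => by rw [fs]; exact le_max_left _ _
  have hnn : ∀ n x, 0 ≤ f n x := fun n x => by
    have := hmono x (Nat.zero_le n)
    simpa [f0] using this
  have hleφ : ∀ n x, f n x ≤ φ x := by
    intro n; induction n with
    | zero => intro x; simpa [f0] using hpos x
    | succ n ih => intro x; rw [fs]; exact max_le (ih x) (hle n x)
  refine ⟨f, ?_, ?_, hnn, hmono, ?_⟩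
  · intro n; induction n with
    | zero => rw [f0]; exact convexOn_const 0 convex_univ
    | succ n ih =>
      rw [fs]
      refine ih.sup ?_
      exact ((l n).toLinearMap.convexOn convex_univ).add (convexOn_const (c n) convex_univ)
  · intro n; induction n with
    | zero => exact ⟨0, by rw [f0]; exact LipschitzWith.const 0⟩
    | succ n ih =>
      obtain ⟨K, hK⟩ := ih
      have h2 : LipschitzWith (‖l n‖₊ + 0) (fun x => l n x + c n) :=
        (l n).lipschitz.add (LipschitzWith.const (c n))
      exact ⟨_, by rw [fs]; exact hK.max h2⟩
  · intro x
    apply le_antisymm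
    · exact iSup_le fun n => ENNReal.ofReal_le_ofReal (hleφ n x)
    · have hx : φ x = ⨆ i, (l i x + c i) := by
        conv_lhs => rw [← hsup]
        have hbdd : BddAbove (range fun i => (l i : ℝ → ℝ) + Function.const ℝ (c i)) :=
          ⟨φ, by rintro _ ⟨i, rfl⟩; exact hle i⟩
        rw [iSup_apply]; rfl
      refine le_of_forall_lt fun b hb => ?_
      have hbt : b ≠ ∞ := hb.ne_top
      have hb' : b.toReal < φ x := (ENNReal.lt_ofReal_iff_toReal_lt hbt).1 hb
      rw [hx] at hb'
      obtain ⟨i, hi⟩ := exists_lt_of_lt_ciSup hb'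
      have h3 : b.toReal < f (i+1) x := by rw [fs]; exact lt_of_lt_of_le hi (le_max_right _ _)
      exact lt_of_lt_of_le ((ENNReal.lt_ofReal_iff_toReal_lt hbt).2 h3)
        (le_iSup (fun n => ENNReal.ofReal (f n x)) (i+1))

lemma convex_order_fun {X Y φ : ℝ → ℝ} (hX : Integrable X I01) (hY : Integrable Y I01)
    (hXm : MonotoneOn X (Ioo (0:ℝ) 1))
    (hq : ∀ q ∈ Icc (0:ℝ) 1, ∫ p in Ioi q, X p ∂I01 ≤ ∫ p in Ioi q, Y p ∂I01)
    (h0 : ∫ p, X p ∂I01 = ∫ p, Y p ∂I01)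
    (hφ : ConvexOn ℝ univ φ) (hpos : ∀ x, 0 ≤ φ x) :
    ∫⁻ p, ENNReal.ofReal (φ (X p)) ∂I01 ≤ ∫⁻ p, ENNReal.ofReal (φ (Y p)) ∂I01 := by
  obtain ⟨f, hfc, hfL, hfn, hfm, hfs⟩ := convex_approx hφ hpos
  simp_rw [← hfs]
  rw [lintegral_iSup']
  · refine iSup_le fun n => ?_
    obtain ⟨K, hK⟩ := hfL n
    have h1 := lip_order hX hY hXm hq h0 (hfc n) hK
    calc ∫⁻ p, ENNReal.ofReal (f n (X p)) ∂I01
        = ENNReal.ofReal (∫ p, f n (X p) ∂I01) :=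
          (ofReal_integral_eq_lintegral_ofReal (lip_integrable hK hX)
            (Filter.Eventually.of_forall fun p => hfn n _)).symm
      _ ≤ ENNReal.ofReal (∫ p, f n (Y p) ∂I01) := ENNReal.ofReal_le_ofReal h1
      _ = ∫⁻ p, ENNReal.ofReal (f n (Y p)) ∂I01 :=
          (ofReal_integral_eq_lintegral_ofReal (lip_integrable hK hY)
            (Filter.Eventually.of_forall fun p => hfn n _))
      _ ≤ _ := lintegral_mono fun p => le_iSup (fun n => ENNReal.ofReal (f n (Y p))) n
  · intro n
    obtain ⟨K, hK⟩ := hfL n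
    exact (hK.continuous.measurable.comp_aemeasurable hX.aemeasurable).ennreal_ofReal
  · exact Filter.Eventually.of_forall fun p n m h => ENNReal.ofReal_le_ofReal (hfm (X p) h)

/-- The (real valued) call function of a measure. -/
def callFn (m : Measure ℝ) (a : ℝ) : ℝ := ∫ x, max (x - a) 0 ∂m

lemma call_int {m : Measure ℝ} [IsProbabilityMeasure m] (hm : Integrable (fun x => x) m) (a : ℝ) :
    Integrable (fun x => max (x - a) 0) m :=
  (hm.sub (integrable_const a)).pos_part

lemma call_quantile (m : Measure ℝ) [IsProbabilityMeasure m] (a : ℝ) :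
    callFn m a = ∫ p, max (quantileFn m p - a) 0 ∂I01 :=
  (integral_quantile m (f := fun x => max (x - a) 0) (by fun_prop)).symm

lemma call_lintegral {m : Measure ℝ} [IsProbabilityMeasure m] (hm : Integrable (fun x => x) m)
    (a : ℝ) : ENNReal.ofReal (callFn m a) = ∫⁻ x, ENNReal.ofReal (x - a) ∂m := by
  rw [callFn, ofReal_integral_eq_lintegral_ofReal (call_int hm a)
    (Filter.Eventually.of_forall fun x => le_max_right _ _)]
  refine lintegral_congr fun x => ?_
  rcases le_total (x - a) 0 with h | h
  · rw [max_eq_right h, ENNReal.ofReal_of_nonpos h]; simp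
  · rw [max_eq_left h]

lemma call_le_of_lintegral {m1 m2 : Measure ℝ} [IsProbabilityMeasure m1] [IsProbabilityMeasure m2]
    (h1 : Integrable (fun x => x) m1) (h2 : Integrable (fun x => x) m2) {a : ℝ}
    (h : ∫⁻ x, ENNReal.ofReal (x - a) ∂m1 ≤ ∫⁻ x, ENNReal.ofReal (x - a) ∂m2) :
    callFn m1 a ≤ callFn m2 a := by
  rw [← call_lintegral h1, ← call_lintegral h2] at h
  exact (ENNReal.ofReal_le_ofReal_iff (integral_nonneg fun x => le_max_right _ _)).1 h

lemma tail_le_pos {f : ℝ → ℝ} (hf : Integrable f I01) (a : ℝ) {q : ℝ} (hq : q ∈ Icc (0:ℝ) 1) :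
    ∫ p in Ioi q, f p ∂I01 ≤ (∫ p, max (f p - a) 0 ∂I01) + a * (1 - q) := by
  have h1 := setIntegral_sub_const hf a hq
  have hp : Integrable (fun p => max (f p - a) 0) I01 := (hf.sub (integrable_const a)).pos_part
  have h2 : ∫ p in Ioi q, (f p - a) ∂I01 ≤ ∫ p in Ioi q, max (f p - a) 0 ∂I01 :=
    integral_mono (hf.sub (integrable_const a)).integrableOn hp.integrableOn
      fun p => le_max_left _ _
  have h3 : ∫ p in Ioi q, max (f p - a) 0 ∂I01 ≤ ∫ p, max (f p - a) 0 ∂I01 :=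
    setIntegral_le_integral hp (Filter.Eventually.of_forall fun p => le_max_right _ _)
  linarith

lemma call_eq (m : Measure ℝ) [IsProbabilityMeasure m] (hm : Integrable (fun x => x) m)
    {q : ℝ} (hq : q ∈ Ioo (0:ℝ) 1) :
    ∫ p in Ioi q, quantileFn m p ∂I01 =
      callFn m (quantileFn m q) + quantileFn m q * (1 - q) := by
  rw [call_quantile]
  set a := quantileFn m q
  have h1 := setIntegral_sub_const (integrable_quantile m hm) a ⟨hq.1.le, hq.2.le⟩
  have h2 : ∫ p, max (quantileFn m p - a) 0 ∂I01 = ∫ p in Ioi q, (quantileFn m p - a) ∂I01 := by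
    rw [← integral_indicator measurableSet_Ioi]
    apply integral_congr_ae
    filter_upwards [ae_restrict_mem measurableSet_Ioo] with p hp
    by_cases h : q < p
    · have := quantile_mono m hq hp h.le
      simp only [indicator, mem_Ioi, h, if_true]
      exact max_eq_left (by linarith)
    · have := quantile_mono m hp hq (not_lt.1 h)
      simp only [indicator, mem_Ioi, h, if_false]
      exact max_eq_right (by linarith)
  linarith

lemma mean_quantile (m : Measure ℝ) [IsProbabilityMeasure m] :
    ∫ p, quantileFn m p ∂I01 = ∫ x, x ∂m := integral_quantile m (f := fun x => x) (by fun_prop)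

lemma quantile_order_of_calls {m1 m2 : Measure ℝ} [IsProbabilityMeasure m1]
    [IsProbabilityMeasure m2]
    (h1 : Integrable (fun x => x) m1) (h2 : Integrable (fun x => x) m2)
    (h : ∀ a, ∫⁻ x, ENNReal.ofReal (x - a) ∂m1 ≤ ∫⁻ x, ENNReal.ofReal (x - a) ∂m2)
    (h0 : ∫ x, x ∂m1 = ∫ x, x ∂m2) :
    ∀ q ∈ Icc (0:ℝ) 1, ∫ p in Ioi q, quantileFn m1 p ∂I01 ≤ ∫ p in Ioi q, quantileFn m2 p ∂I01 := by
  intro q hq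
  rcases eq_or_lt_of_le hq.1 with rfl | hq0
  · rw [restrict_Ioi_zero, mean_quantile, mean_quantile, h0]
  rcases eq_or_lt_of_le hq.2 with rfl | hq1
  · rw [restrict_Ioi_one]; simp
  rw [call_eq m2 h2 ⟨hq0, hq1⟩]
  have h3 := tail_le_pos (integrable_quantile m1 h1) (quantileFn m2 q) hq
  rw [← call_quantile] at h3
  linarith [call_le_of_lintegral h1 h2 (h (quantileFn m2 q))]

lemma convexOrder_of_quantile {m1 m2 : Measure ℝ} [IsProbabilityMeasure m1]
    [IsProbabilityMeasure m2]
    (h1 : Integrable (fun x => x) m1) (h2 : Integrable (fun x => x) m2)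
    (h : ∀ q ∈ Icc (0:ℝ) 1,
      ∫ p in Ioi q, quantileFn m1 p ∂I01 ≤ ∫ p in Ioi q, quantileFn m2 p ∂I01)
    (h0 : ∫ x, x ∂m1 = ∫ x, x ∂m2) : ConvexOrder m1 m2 := by
  have hc : ∀ φ : ℝ → ℝ, ConvexOn ℝ univ φ → Continuous φ := by
    intro φ hφ
    have := hφ.continuousOn_interior
    rw [interior_univ] at this
    exact continuousOn_univ.1 this
  have key : ∀ φ : ℝ → ℝ, ConvexOn ℝ univ φ → (∀ x, 0 ≤ φ x) →
      ∫⁻ x, ENNReal.ofReal (φ x) ∂m1 ≤ ∫⁻ x, ENNReal.ofReal (φ x) ∂m2 := by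
    intro φ hφ hpos
    have hm : Measurable fun x => ENNReal.ofReal (φ x) := (hc φ hφ).measurable.ennreal_ofReal
    rw [← lintegral_quantile m1 hm, ← lintegral_quantile m2 hm]
    exact convex_order_fun (integrable_quantile m1 h1) (integrable_quantile m2 h2)
      (quantile_mono m1) h (by rw [mean_quantile, mean_quantile, h0]) hφ hpos
  refine ⟨key, fun φ hφ hφi => ?_⟩
  have hi1 := hφi.left_of_add_measure
  have hi2 := hφi.right_of_add_measure
  let s := derivWithin φ (Ioi 0) 0
  have hle : ∀ x, φ 0 + s * x ≤ φ x := fun x => by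
    simpa using convex_subgrad hφ 0 x
  have hcx : ConvexOn ℝ univ (fun x => φ x - (φ 0 + s * x)) := by
    refine hφ.sub ?_
    refine (concaveOn_const (φ 0) convex_univ).add ?_
    exact (LinearMap.mul ℝ ℝ s).concaveOn convex_univ
  have h3 := key _ hcx (fun x => by linarith [hle x])
  have ia1 : Integrable (fun x => φ 0 + s * x) m1 := (integrable_const _).add (h1.const_mul s)
  have ia2 : Integrable (fun x => φ 0 + s * x) m2 := (integrable_const _).add (h2.const_mul s)
  have hnn : ∀ x, 0 ≤ φ x - (φ 0 + s * x) := fun x => by linarith [hle x]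
  have is1 : Integrable (fun x => φ x - (φ 0 + s * x)) m1 := hi1.sub ia1
  have is2 : Integrable (fun x => φ x - (φ 0 + s * x)) m2 := hi2.sub ia2
  rw [← ofReal_integral_eq_lintegral_ofReal is1 (Filter.Eventually.of_forall hnn),
    ← ofReal_integral_eq_lintegral_ofReal is2 (Filter.Eventually.of_forall hnn)] at h3
  have h4 := (ENNReal.ofReal_le_ofReal_iff (integral_nonneg hnn)).1 h3
  rw [integral_sub hi1 ia1, integral_sub hi2 ia2,
    integral_add (integrable_const _) (h1.const_mul s),
    integral_add (integrable_const _) (h2.const_mul s), integral_const_mul, integral_const_mul,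
    h0] at h4
  simp only [integral_const, probReal_univ, smul_eq_mul, one_mul] at h4
  linarith

lemma of_convexOrder {m1 m2 : Measure ℝ} [IsProbabilityMeasure m1] [IsProbabilityMeasure m2]
    (h1 : Integrable (fun x => x) m1) (h2 : Integrable (fun x => x) m2)
    (h : ConvexOrder m1 m2) :
    (∫ x, x ∂m1 = ∫ x, x ∂m2) ∧ ∀ q ∈ Icc (0:ℝ) 1,
      ∫ p in Ioi q, quantileFn m1 p ∂I01 ≤ ∫ p in Ioi q, quantileFn m2 p ∂I01 := by
  have hm : ∫ x, x ∂m1 = ∫ x, x ∂m2 := by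
    apply le_antisymm
    · exact h.2 (fun x => x) (convexOn_id convex_univ) (h1.add_measure h2)
    · have := h.2 (fun x => -x) ((concaveOn_id convex_univ).neg) (h1.neg.add_measure h2.neg)
      rw [integral_neg, integral_neg] at this
      linarith
  refine ⟨hm, quantile_order_of_calls h1 h2 (fun a => ?_) hm⟩
  have hcx : ConvexOn ℝ univ (fun x : ℝ => max (x - a) 0) := by
    refine ConvexOn.sup ?_ (convexOn_const 0 convex_univ)
    exact (convexOn_id convex_univ).sub (concaveOn_const a convex_univ)
  have := h.1 _ hcx (fun x => le_max_right _ _)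
  have e : ∀ x : ℝ, ENNReal.ofReal (max (x - a) 0) = ENNReal.ofReal (x - a) := by
    intro x
    rcases le_total (x - a) 0 with h | h
    · rw [max_eq_right h, ENNReal.ofReal_of_nonpos h]; simp
    · rw [max_eq_left h]
  simpa only [e] using this

lemma convexOn_abs_rpow {ρ : ℝ} (hρ : 1 < ρ) : ConvexOn ℝ univ (fun x : ℝ => |x| ^ ρ) := by
  refine ⟨convex_univ, fun x _ y _ a b ha hb hab => ?_⟩
  have h1 : |a • x + b • y| ≤ a * |x| + b * |y| := by
    refine (abs_add_le _ _).trans ?_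
    simp [abs_mul, abs_of_nonneg ha, abs_of_nonneg hb]
  have h2 := (convexOn_rpow hρ.le).2 (abs_nonneg x) (abs_nonneg y) ha hb hab
  simp only [smul_eq_mul] at h2 ⊢
  exact (Real.rpow_le_rpow (abs_nonneg _) h1 (by linarith)).trans h2

lemma tonelli_call (π : Measure (ℝ × ℝ)) [IsProbabilityMeasure π] (a : ℝ) :
    ∫⁻ z, ENNReal.ofReal (z.2 - z.1 - a) ∂π = ∫⁻ b, π ({z | z.1 ≤ b - a} ∩ {z | b < z.2}) := by
  let S : Set ((ℝ × ℝ) × ℝ) := {w | w.1.1 ≤ w.2 - a} ∩ {w | w.2 < w.1.2}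
  have hS : MeasurableSet S :=
    (measurableSet_le (by fun_prop) (by fun_prop)).inter (measurableSet_lt (by fun_prop) (by fun_prop))
  have h1 : ∀ z : ℝ × ℝ, ENNReal.ofReal (z.2 - z.1 - a) =
      ∫⁻ b, S.indicator (fun _ => (1:ℝ≥0∞)) (z, b) := by
    intro z
    have : ∀ b, S.indicator (fun _ => (1:ℝ≥0∞)) (z, b) =
        (Ico (z.1 + a) z.2).indicator (fun _ => (1:ℝ≥0∞)) b := by
      intro b
      simp only [S, indicator, mem_inter_iff, mem_ofPred_eq, mem_Ico, le_sub_iff_add_le]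
    simp_rw [this]
    rw [lintegral_indicator measurableSet_Ico]
    simp [sub_sub]
  have h2 : ∀ b, π ({z | z.1 ≤ b - a} ∩ {z | b < z.2}) =
      ∫⁻ z, S.indicator (fun _ => (1:ℝ≥0∞)) (z, b) ∂π := by
    intro b
    have hm : MeasurableSet ({z : ℝ × ℝ | z.1 ≤ b - a} ∩ {z | b < z.2}) :=
      (measurableSet_le (by fun_prop) (by fun_prop)).inter
        (measurableSet_lt (by fun_prop) (by fun_prop))
    rw [← lintegral_indicator_one hm]
    rfl
  simp_rw [h1, h2]
  rw [lintegral_lintegral_swap]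
  exact (measurable_const.indicator hS).aemeasurable

lemma cx_transfer {Ω₁ Ω₂ : Type*} [MeasurableSpace Ω₁] [MeasurableSpace Ω₂] {P₁ : Measure Ω₁}
    {P₂ : Measure Ω₂} [IsProbabilityMeasure P₁] [IsProbabilityMeasure P₂] {X₁ : Ω₁ → ℝ}
    {X₂ : Ω₂ → ℝ} (h1 : Integrable X₁ P₁) (h2 : Integrable X₂ P₂)
    (h0 : ∫ w, X₁ w ∂P₁ = ∫ w, X₂ w ∂P₂)
    (h : ∀ a, ∫⁻ w, ENNReal.ofReal (X₁ w - a) ∂P₁ ≤ ∫⁻ w, ENNReal.ofReal (X₂ w - a) ∂P₂)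
    {ρ : ℝ} (hρ : 1 < ρ) :
    ∫⁻ w, ENNReal.ofReal (|X₁ w| ^ ρ) ∂P₁ ≤ ∫⁻ w, ENNReal.ofReal (|X₂ w| ^ ρ) ∂P₂ := by
  have hm1 := h1.aemeasurable
  have hm2 := h2.aemeasurable
  have := Measure.isProbabilityMeasure_map hm1
  have := Measure.isProbabilityMeasure_map hm2
  have i1 : Integrable (fun x : ℝ => x) (P₁.map X₁) := by
    rw [integrable_map_measure (by fun_prop) hm1]; exact h1
  have i2 : Integrable (fun x : ℝ => x) (P₂.map X₂) := by
    rw [integrable_map_measure (by fun_prop) hm2]; exact h2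
  have e0 : ∫ x, x ∂(P₁.map X₁) = ∫ x, x ∂(P₂.map X₂) := by
    rw [integral_map hm1 (by fun_prop), integral_map hm2 (by fun_prop), h0]
  have hcx := convexOrder_of_quantile i1 i2 (quantile_order_of_calls i1 i2 (fun a => by
    rw [lintegral_map' (by fun_prop) hm1, lintegral_map' (by fun_prop) hm2]; exact h a) e0) e0
  have := hcx.1 _ (convexOn_abs_rpow hρ) (fun x => by positivity)
  rwa [lintegral_map' (by fun_prop) hm1, lintegral_map' (by fun_prop) hm2] at this

/-- The comonotone coupling. -/
def comono (ν η : Measure ℝ) : Measure (ℝ × ℝ) := I01.map (fun p => (quantileFn ν p, quantileFn η p))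

lemma prod_aem (ν η : Measure ℝ) [IsProbabilityMeasure ν] [IsProbabilityMeasure η] :
    AEMeasurable (fun p => (quantileFn ν p, quantileFn η p)) I01 :=
  (quantile_aem ν).prodMk (quantile_aem η)

lemma comono_fst (ν η : Measure ℝ) [IsProbabilityMeasure ν] [IsProbabilityMeasure η] :
    (comono ν η).map Prod.fst = ν := by
  rw [comono, AEMeasurable.map_map_of_aemeasurable (by fun_prop) (prod_aem ν η)]
  exact map_quantile ν

lemma comono_snd (ν η : Measure ℝ) [IsProbabilityMeasure ν] [IsProbabilityMeasure η] :
    (comono ν η).map Prod.snd = η := by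
  rw [comono, AEMeasurable.map_map_of_aemeasurable (by fun_prop) (prod_aem ν η)]
  exact map_quantile η

lemma comono_call_le (ν η : Measure ℝ) [IsProbabilityMeasure ν] [IsProbabilityMeasure η]
    (π : Measure (ℝ × ℝ)) [IsProbabilityMeasure π] (h1 : π.map Prod.fst = ν)
    (h2 : π.map Prod.snd = η) (a : ℝ) :
    ∫⁻ p, ENNReal.ofReal (quantileFn η p - quantileFn ν p - a) ∂I01 ≤
      ∫⁻ z, ENNReal.ofReal (z.2 - z.1 - a) ∂π := by
  have hP : IsProbabilityMeasure (comono ν η) := Measure.isProbabilityMeasure_map (prod_aem ν η)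
  have e : ∫⁻ p, ENNReal.ofReal (quantileFn η p - quantileFn ν p - a) ∂I01 =
      ∫⁻ z, ENNReal.ofReal (z.2 - z.1 - a) ∂(comono ν η) := by
    rw [comono, lintegral_map' (by fun_prop) (prod_aem ν η)]
  rw [e, tonelli_call, tonelli_call]
  refine lintegral_mono fun b => ?_
  have hm1 : MeasurableSet {z : ℝ × ℝ | z.1 ≤ b - a} := measurableSet_le (by fun_prop) (by fun_prop)
  have hm2 : MeasurableSet {z : ℝ × ℝ | b < z.2} := measurableSet_lt (by fun_prop) (by fun_prop)
  calc comono ν η ({z | z.1 ≤ b - a} ∩ {z | b < z.2})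
      ≤ ν (Iic (b - a)) - η (Iic b) := by
        rw [comono, Measure.map_apply_of_aemeasurable (prod_aem ν η) (hm1.inter hm2)]
        have h3 : I01 ((fun p => (quantileFn ν p, quantileFn η p)) ⁻¹'
            ({z | z.1 ≤ b - a} ∩ {z | b < z.2})) =
            I01 (Ioc (η.real (Iic b)) (ν.real (Iic (b - a)))) := by
          apply measure_congr
          filter_upwards [ae_restrict_mem measurableSet_Ioo] with p hp
          apply propext
          change (quantileFn ν p ≤ b - a ∧ b < quantileFn η p) ↔ (_ < p ∧ p ≤ _)
          rw [quantile_le_iff ν hp, ← not_le, quantile_le_iff η hp, not_le, and_comm]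
        rw [h3]
        refine (Measure.restrict_apply_le _ _).trans ?_
        rw [Real.volume_Ioc, ENNReal.ofReal_sub _ measureReal_nonneg, ofReal_measureReal,
          ofReal_measureReal]
    _ ≤ π ({z | z.1 ≤ b - a} ∩ {z | b < z.2}) := by
        rw [tsub_le_iff_right, ← h1, ← h2, Measure.map_apply measurable_fst measurableSet_Iic,
          Measure.map_apply measurable_snd measurableSet_Iic]
        refine (measure_mono ?_).trans (measure_union_le _ _)
        intro z hz
        by_cases h : b < z.2
        · exact Or.inl ⟨hz, h⟩
        · exact Or.inr (not_lt.1 h)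

lemma prob_of_fst {ν : Measure ℝ} [IsProbabilityMeasure ν] {π : Measure (ℝ × ℝ)}
    (h1 : π.map Prod.fst = ν) : IsProbabilityMeasure π := by
  constructor
  have : (π.map Prod.fst) univ = 1 := by rw [h1]; simp
  rwa [Measure.map_apply measurable_fst MeasurableSet.univ, preimage_univ] at this

/-- The transport cost of the comonotone coupling. -/
def qcost (ρ : ℝ) (ν η : Measure ℝ) : ℝ≥0∞ :=
  ∫⁻ p, ENNReal.ofReal (|quantileFn η p - quantileFn ν p| ^ ρ) ∂I01

lemma Wp_le_qcost (ρ : ℝ) (ν η : Measure ℝ) [IsProbabilityMeasure ν] [IsProbabilityMeasure η] :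
    Wp ρ ν η ≤ qcost ρ ν η := by
  refine (iInf₂_le (comono ν η) (comono_fst ν η)).trans ?_
  refine (iInf_le _ (comono_snd ν η)).trans ?_
  rw [comono, lintegral_map' (by fun_prop) (prod_aem ν η), qcost]
  refine lintegral_mono fun p => ?_
  rw [Real.norm_eq_abs, abs_sub_comm]

lemma qcost_le_Wp {ρ : ℝ} (hρ : 1 < ρ) {ν η : Measure ℝ} [IsProbabilityMeasure ν]
    [IsProbabilityMeasure η] (hν : Integrable (fun x => x) ν) (hη : Integrable (fun x => x) η) :
    qcost ρ ν η ≤ Wp ρ ν η := by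
  refine le_iInf fun π => le_iInf fun h1 => le_iInf fun h2 => ?_
  have := prob_of_fst h1
  have i1 : Integrable (fun z : ℝ × ℝ => z.1) π := by
    rw [← h1, integrable_map_measure (by fun_prop) (by fun_prop)] at hν; exact hν
  have i2 : Integrable (fun z : ℝ × ℝ => z.2) π := by
    rw [← h2, integrable_map_measure (by fun_prop) (by fun_prop)] at hη; exact hη
  have e1 : ∫ z, z.1 ∂π = ∫ x, x ∂ν := by
    rw [← h1, integral_map (by fun_prop) (by fun_prop)]
  have e2 : ∫ z, z.2 ∂π = ∫ x, x ∂η := by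
    rw [← h2, integral_map (by fun_prop) (by fun_prop)]
  have key := cx_transfer (P₁ := I01) (P₂ := π)
    (X₁ := fun p => quantileFn η p - quantileFn ν p) (X₂ := fun z => z.2 - z.1)
    ((integrable_quantile η hη).sub (integrable_quantile ν hν)) (i2.sub i1)
    (by rw [integral_sub (integrable_quantile η hη) (integrable_quantile ν hν),
          integral_sub i2 i1, mean_quantile, mean_quantile, e1, e2])
    (comono_call_le ν η π h1 h2) hρ
  refine key.trans (lintegral_mono fun z => ?_)
  rw [Real.norm_eq_abs, abs_sub_comm]

lemma integrable_of_Wp {ρ : ℝ} (hρ : 1 < ρ) {ν η : Measure ℝ} [IsProbabilityMeasure ν]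
    (hν : Integrable (fun x => x) ν) (h : Wp ρ ν η ≠ ∞) :
    Integrable (fun x => x) η := by
  have hρ0 : 0 ≤ ρ := by linarith
  have hlt : Wp ρ ν η < ∞ := lt_top_iff_ne_top.2 h
  unfold Wp at hlt
  simp only [iInf_lt_iff] at hlt
  obtain ⟨π, h1, h2, hπ⟩ := hlt
  have := prob_of_fst h1
  have i1 : Integrable (fun z : ℝ × ℝ => z.1) π := by
    rw [← h1, integrable_map_measure (by fun_prop) (by fun_prop)] at hν; exact hν
  have i3 : Integrable (fun z : ℝ × ℝ => ‖z.1 - z.2‖ ^ ρ) π := by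
    refine ⟨by fun_prop (disch := assumption), ?_⟩
    rw [hasFiniteIntegral_iff_ofReal (Filter.Eventually.of_forall fun z => by positivity)]
    exact hπ
  rw [← h2, integrable_map_measure (by fun_prop) (by fun_prop)]
  refine Integrable.mono' ((i1.abs.add (integrable_const 1)).add i3) (by fun_prop) ?_
  refine Filter.Eventually.of_forall fun z => ?_
  change |z.2| ≤ |z.1| + 1 + ‖z.1 - z.2‖ ^ ρ
  rw [Real.norm_eq_abs]
  have h4 : |z.2| ≤ |z.1| + |z.1 - z.2| := by
    have := abs_sub_abs_le_abs_sub z.2 z.1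
    rw [abs_sub_comm] at this; linarith
  rcases le_total (|z.1 - z.2|) 1 with h5 | h5
  · have : 0 ≤ |z.1 - z.2| ^ ρ := by positivity
    linarith
  · have : |z.1 - z.2| ≤ |z.1 - z.2| ^ ρ := Real.self_le_rpow_of_one_le h5 hρ.le
    linarith

lemma qcost_ne_top {ρ : ℝ} (hρ : 1 < ρ) {ν η : Measure ℝ} [IsProbabilityMeasure ν]
    [IsProbabilityMeasure η] (hν : Integrable (fun x => |x| ^ ρ) ν)
    (hη : Integrable (fun x => |x| ^ ρ) η) : qcost ρ ν η ≠ ∞ := by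
  have hρ0 : 0 ≤ ρ := by linarith
  have i1 : Integrable (fun p => |quantileFn ν p| ^ ρ) I01 := by
    rw [← map_quantile ν, integrable_map_measure (by fun_prop (disch := assumption)) (quantile_aem ν)] at hν; exact hν
  have i2 : Integrable (fun p => |quantileFn η p| ^ ρ) I01 := by
    rw [← map_quantile η, integrable_map_measure (by fun_prop (disch := assumption)) (quantile_aem η)] at hη; exact hη
  have i3 : Integrable (fun p => |quantileFn η p - quantileFn ν p| ^ ρ) I01 := by
    have hm : AEMeasurable (fun p => |quantileFn η p - quantileFn ν p| ^ ρ) I01 := by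
      have hg : Measurable fun x : ℝ => |x| ^ ρ := by fun_prop
      exact hg.comp_aemeasurable ((quantile_aem η).sub (quantile_aem ν))
    refine Integrable.mono' ((i1.add i2).const_mul (2 ^ ρ)) hm.aestronglyMeasurable ?_
    refine Filter.Eventually.of_forall fun p => ?_
    rw [Real.norm_eq_abs, abs_of_nonneg (by positivity)]
    change _ ≤ 2 ^ ρ * (|quantileFn ν p| ^ ρ + |quantileFn η p| ^ ρ)
    set x := quantileFn ν p
    set y := quantileFn η p
    have hx : 0 ≤ |x| ^ ρ := by positivity
    have hy : 0 ≤ |y| ^ ρ := by positivity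
    have h2 : (0:ℝ) ≤ 2 ^ ρ := by positivity
    have h0 : |y - x| ≤ |y| + |x| := abs_sub _ _
    rcases le_total |x| |y| with h | h
    · calc |y - x| ^ ρ ≤ (2 * |y|) ^ ρ := Real.rpow_le_rpow (abs_nonneg _) (by linarith) (by linarith)
        _ = 2 ^ ρ * |y| ^ ρ := Real.mul_rpow (by norm_num) (abs_nonneg _)
        _ ≤ _ := mul_le_mul_of_nonneg_left (by linarith) h2
    · calc |y - x| ^ ρ ≤ (2 * |x|) ^ ρ := Real.rpow_le_rpow (abs_nonneg _) (by linarith) (by linarith)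
        _ = 2 ^ ρ * |x| ^ ρ := Real.mul_rpow (by norm_num) (abs_nonneg _)
        _ ≤ _ := mul_le_mul_of_nonneg_left (by linarith) h2
  have := i3.2
  rw [hasFiniteIntegral_iff_ofReal (Filter.Eventually.of_forall fun z => by positivity)] at this
  exact this.ne

lemma hull_left {G ψ : ℝ → ℝ} (hG : ContinuousOn G (Icc 0 1)) (hψ : ConcaveOn ℝ (Icc 0 1) ψ)
    (hge : ∀ q ∈ Icc (0:ℝ) 1, G q ≤ ψ q)
    (hmin : ∀ a b : ℝ, (∀ q ∈ Icc (0:ℝ) 1, G q ≤ a + b * q) → ∀ q ∈ Icc (0:ℝ) 1, ψ q ≤ a + b * q) :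
    ψ 0 = G 0 ∧ ContinuousWithinAt ψ (Icc 0 1) 0 := by
  have h00 : (0:ℝ) ∈ Icc (0:ℝ) 1 := by simp
  have h11 : (1:ℝ) ∈ Icc (0:ℝ) 1 := by simp
  have key : ∀ ε > 0, ∃ K : ℝ, ∀ q ∈ Icc (0:ℝ) 1, ψ q ≤ G 0 + ε + K * q := by
    intro ε hε
    obtain ⟨B, hB⟩ := (isCompact_Icc.image_of_continuousOn hG).bddAbove
    have hc := hG 0 h00
    rw [Metric.continuousWithinAt_iff] at hc
    obtain ⟨δ, hδ, hd⟩ := hc ε hε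
    refine ⟨(|B| + |G 0|) / δ, ?_⟩
    refine hmin _ _ fun q hq => ?_
    have hK : 0 ≤ (|B| + |G 0|) / δ := by positivity
    rcases lt_or_ge q δ with h | h
    · have := hd hq (by rw [Real.dist_eq, sub_zero, abs_of_nonneg hq.1]; exact h)
      rw [Real.dist_eq] at this
      have h2 := (abs_lt.1 this).2
      have := mul_nonneg hK hq.1
      linarith
    · have h1 : G q ≤ B := hB ⟨q, hq, rfl⟩
      have h2 : |B| + |G 0| ≤ (|B| + |G 0|) / δ * q := by
        rw [div_mul_eq_mul_div, le_div_iff₀ hδ]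
        exact mul_le_mul_of_nonneg_left h (by positivity)
      have := le_abs_self B
      have := neg_abs_le (G 0)
      linarith
  have e0 : ψ 0 = G 0 := by
    apply le_antisymm _ (hge 0 h00)
    refine le_of_forall_pos_le_add fun ε hε => ?_
    obtain ⟨K, hK⟩ := key ε hε
    simpa using hK 0 h00
  refine ⟨e0, ?_⟩
  refine tendsto_order.2 ⟨fun a ha => ?_, fun b hb => ?_⟩
  · have hc : Filter.Tendsto (fun q : ℝ => (1 - q) * ψ 0 + q * ψ 1) (nhdsWithin 0 (Icc 0 1))
        (nhds ((1 - 0) * ψ 0 + 0 * ψ 1)) :=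
      (Continuous.tendsto (by fun_prop) 0).mono_left nhdsWithin_le_nhds
    have := hc.eventually (lt_mem_nhds (a := a) (by simpa using ha))
    filter_upwards [this, self_mem_nhdsWithin] with q hq hqI
    refine lt_of_lt_of_le hq ?_
    have := hψ.2 h00 h11 (sub_nonneg.2 hqI.2) hqI.1 (by ring)
    simpa using this
  · obtain ⟨K, hK⟩ := key ((b - ψ 0) / 2) (by linarith)
    have hc : Filter.Tendsto (fun q : ℝ => G 0 + (b - ψ 0) / 2 + K * q) (nhdsWithin 0 (Icc 0 1))
        (nhds (G 0 + (b - ψ 0) / 2 + K * 0)) :=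
      (Continuous.tendsto (by fun_prop) 0).mono_left nhdsWithin_le_nhds
    have hlt : G 0 + (b - ψ 0) / 2 + K * 0 < b := by
      have : ψ 0 < b := hb
      rw [← e0]; linarith
    have := hc.eventually (gt_mem_nhds hlt)
    filter_upwards [this, self_mem_nhdsWithin] with q hq hqI
    exact lt_of_le_of_lt (hK q hqI) hq

lemma hull_cont {G ψ : ℝ → ℝ} (hG : ContinuousOn G (Icc 0 1)) (hψ : ConcaveOn ℝ (Icc 0 1) ψ)
    (hge : ∀ q ∈ Icc (0:ℝ) 1, G q ≤ ψ q)
    (hmin : ∀ a b : ℝ, (∀ q ∈ Icc (0:ℝ) 1, G q ≤ a + b * q) → ∀ q ∈ Icc (0:ℝ) 1, ψ q ≤ a + b * q) :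
    ψ 0 = G 0 ∧ ψ 1 = G 1 ∧ ContinuousOn ψ (Icc 0 1) := by
  obtain ⟨h0, hc0⟩ := hull_left hG hψ hge hmin
  have hmem : ∀ q ∈ Icc (0:ℝ) 1, 1 - q ∈ Icc (0:ℝ) 1 := fun q hq =>
    ⟨by linarith [hq.2], by linarith [hq.1]⟩
  have hmap : MapsTo (fun q : ℝ => 1 - q) (Icc 0 1) (Icc 0 1) := hmem
  obtain ⟨h1, hc1⟩ := hull_left (G := fun q => G (1 - q)) (ψ := fun q => ψ (1 - q))
    (hG.comp (by fun_prop) hmap)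
    ⟨convex_Icc 0 1, fun x hx y hy a b ha hb hab => by
      have := hψ.2 (hmem x hx) (hmem y hy) ha hb hab
      have e : a • (1 - x) + b • (1 - y) = 1 - (a • x + b • y) := by
        simp only [smul_eq_mul]; linear_combination hab
      rw [e] at this; exact this⟩
    (fun q hq => hge _ (hmem q hq))
    (fun a b h q hq => by
      have := hmin (a + b) (-b) (fun r hr => by
        have := h (1 - r) (hmem r hr)
        simp only [sub_sub_cancel] at this
        linarith) (1 - q) (hmem q hq)
      linarith)
  simp only [sub_zero] at h1
  refine ⟨h0, h1, fun q hq => ?_⟩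
  rcases eq_or_lt_of_le hq.1 with rfl | hq0
  · exact hc0
  rcases eq_or_lt_of_le hq.2 with rfl | hq1
  · have h2 : ContinuousWithinAt (fun q : ℝ => 1 - q) (Icc 0 1) 1 := by fun_prop
    have h3 := ContinuousWithinAt.comp_of_eq hc1 h2 hmap (by simp)
    have e : (fun q => ψ (1 - q)) ∘ (fun q : ℝ => 1 - q) = ψ := by
      ext r; simp
    rwa [e] at h3
  · have := hψ.continuousOn_interior
    rw [interior_Icc] at this
    exact (this.continuousAt (Ioo_mem_nhds hq0 hq1)).continuousWithinAt

lemma concave_deriv {ψ : ℝ → ℝ} (hψ : ConcaveOn ℝ (Icc 0 1) ψ) (hc : ContinuousOn ψ (Icc 0 1)) :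
    ∃ Z : ℝ → ℝ, MonotoneOn Z (Ioo (0:ℝ) 1) ∧ Integrable Z I01 ∧
      ∀ q ∈ Icc (0:ℝ) 1, ∫ p in Ioi q, Z p ∂I01 = ψ q - ψ 1 := by
  have hf := hψ.neg
  let Z : ℝ → ℝ := fun p => derivWithin (-ψ) (Ioi p) p
  have hmono : MonotoneOn Z (Ioo (0:ℝ) 1) := by
    have := hf.monotoneOn_rightDeriv
    rwa [interior_Icc] at this
  have hder : ∀ p ∈ Ioo (0:ℝ) 1, HasDerivWithinAt (-ψ) (Z p) (Ioi p) p := fun p hp =>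
    hf.hasDerivWithinAt_rightDeriv_of_mem_interior (by rwa [interior_Icc])
  have hhalf : (1/2 : ℝ) ∈ Ioo (0:ℝ) 1 := by norm_num
  let c := Z (1/2)
  have iR : IntegrableOn Z (Ioc (1/2) 1) := by
    have h1 : IntegrableOn (fun p => Z p - c) (Ioc (1/2) 1) := by
      refine intervalIntegral.integrableOn_deriv_right_of_nonneg (g := fun p => (-ψ) p - c * p)
        ?_ ?_ ?_
      · have : ContinuousOn (-ψ) (Icc (1/2) 1) := hc.neg.mono (Icc_subset_Icc_left (by norm_num))
        exact this.sub (by fun_prop)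
      · intro x hx
        have h2 := (hasDerivWithinAt_id x (Ioi x)).const_mul c
        have h3 := (hder x ⟨by linarith [hx.1], hx.2⟩).sub h2
        rw [mul_one] at h3
        exact h3
      · intro x hx
        have := hmono hhalf ⟨by linarith [hx.1], hx.2⟩ hx.1.le
        simp only [c]; linarith
    have h2 := h1.add (integrableOn_const (μ := volume) (s := Ioc (1/2:ℝ) 1) (C := c) (by simp))
    refine h2.congr_fun (fun p _ => by simp) measurableSet_Ioc
  have iL : IntegrableOn Z (Ioc 0 (1/2)) := by
    have h1 : IntegrableOn (fun p => c - Z p) (Ioc 0 (1/2)) := by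
      refine intervalIntegral.integrableOn_deriv_right_of_nonneg (g := fun p => c * p - (-ψ) p)
        ?_ ?_ ?_
      · have : ContinuousOn (-ψ) (Icc 0 (1/2)) := hc.neg.mono (Icc_subset_Icc_right (by norm_num))
        exact ContinuousOn.sub (by fun_prop) this
      · intro x hx
        have h2 := (hasDerivWithinAt_id x (Ioi x)).const_mul c
        have h3 := h2.sub (hder x ⟨hx.1, by linarith [hx.2]⟩)
        rw [mul_one] at h3
        exact h3
      · intro x hx
        have := hmono ⟨hx.1, by linarith [hx.2]⟩ hhalf hx.2.le
        simp only [c]; linarith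
    have h2 := (integrableOn_const (μ := volume) (s := Ioc (0:ℝ) (1/2)) (C := c) (by simp)).sub h1
    refine h2.congr_fun (fun p _ => by simp) measurableSet_Ioc
  have iT : IntegrableOn Z (Ioc 0 1) := by
    have := iL.union iR
    rwa [Ioc_union_Ioc_eq_Ioc (by norm_num) (by norm_num)] at this
  refine ⟨Z, hmono, iT.mono_set Ioo_subset_Ioc_self, fun q hq => ?_⟩
  rw [← ii_eq Z hq, intervalIntegral.integral_eq_sub_of_hasDeriv_right_of_le hq.2
    (f := -ψ) (hc.neg.mono (Icc_subset_Icc_left hq.1))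
    (fun x hx => hder x ⟨lt_of_le_of_lt hq.1 hx.1, hx.2⟩)]
  · simp only [Pi.neg_apply]; ring
  · rw [intervalIntegrable_iff_integrableOn_Ioc_of_le hq.2]
    exact iT.mono_set (Ioc_subset_Ioc_left hq.1)

lemma rpow_mid_lt {ρ : ℝ} (hρ : 1 < ρ) {y z : ℝ} (h : y ≠ z) :
    |(y + z) / 2| ^ ρ < (|y| ^ ρ + |z| ^ ρ) / 2 := by
  by_cases hyz : |y| = |z|
  · rcases abs_eq_abs.1 hyz with h1 | h1
    · exact absurd h1 h
    · have hz : z ≠ 0 := by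
        rintro rfl
        apply h; rw [h1]; simp
      have e : (y + z) / 2 = 0 := by rw [h1]; ring
      rw [e, hyz, abs_zero, Real.zero_rpow (by linarith)]
      have : 0 < |z| ^ ρ := Real.rpow_pos_of_pos (abs_pos.2 hz) _
      linarith
  · have h1 : |(y + z) / 2| ≤ (|y| + |z|) / 2 := by
      rw [abs_div, abs_of_pos (by norm_num : (0:ℝ) < 2)]
      have := abs_add_le y z
      linarith
    have h2 := (strictConvexOn_rpow hρ).2 (abs_nonneg y) (abs_nonneg z) hyz
      (by norm_num : (0:ℝ) < 1/2) (by norm_num : (0:ℝ) < 1/2) (by norm_num)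
    simp only [smul_eq_mul] at h2
    calc |(y + z) / 2| ^ ρ ≤ ((|y| + |z|) / 2) ^ ρ :=
          Real.rpow_le_rpow (abs_nonneg _) h1 (by linarith)
      _ = (1/2 * |y| + 1/2 * |z|) ^ ρ := by congr 1; ring
      _ < _ := h2
      _ = _ := by ring

lemma rpow_mid_le {ρ : ℝ} (hρ : 1 < ρ) (y z : ℝ) :
    |(y + z) / 2| ^ ρ ≤ (|y| ^ ρ + |z| ^ ρ) / 2 := by
  by_cases h : y = z
  · subst h
    have : (y + y) / 2 = y := by ring
    rw [this]; linarith
  · exact (rpow_mid_lt hρ h).le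

lemma min_unique {ρ : ℝ} (hρ : 1 < ρ) {Y Z : ℝ → ℝ} (hYm : AEMeasurable Y I01)
    (hZm : AEMeasurable Z I01) (hZ : ∫⁻ p, ENNReal.ofReal (|Z p| ^ ρ) ∂I01 ≠ ∞)
    (hY : ∫⁻ p, ENNReal.ofReal (|Y p| ^ ρ) ∂I01 ≤ ∫⁻ p, ENNReal.ofReal (|Z p| ^ ρ) ∂I01)
    (hm : ∫⁻ p, ENNReal.ofReal (|Z p| ^ ρ) ∂I01
      ≤ ∫⁻ p, ENNReal.ofReal (|(Y p + Z p) / 2| ^ ρ) ∂I01) : Y =ᵐ[I01] Z := by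
  have mm : ∀ W : ℝ → ℝ, AEMeasurable W I01 → AEStronglyMeasurable (fun p => |W p| ^ ρ) I01 := by
    intro W hW
    have : Measurable (fun x : ℝ => |x| ^ ρ) := by fun_prop
    exact (this.comp_aemeasurable hW).aestronglyMeasurable
  have nn : ∀ W : ℝ → ℝ, 0 ≤ᵐ[I01] (fun p => |W p| ^ ρ) := fun W =>
    Filter.Eventually.of_forall fun p => Real.rpow_nonneg (abs_nonneg _) _
  have iZ : Integrable (fun p => |Z p| ^ ρ) I01 :=
    (lintegral_ofReal_ne_top_iff_integrable (mm Z hZm) (nn Z)).1 hZ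
  have iY : Integrable (fun p => |Y p| ^ ρ) I01 :=
    (lintegral_ofReal_ne_top_iff_integrable (mm Y hYm) (nn Y)).1 (ne_top_of_le_ne_top hZ hY)
  have iM : Integrable (fun p => |(Y p + Z p) / 2| ^ ρ) I01 := by
    refine ((iY.add iZ).div_const 2).mono' (mm (fun p => (Y p + Z p) / 2) (by fun_prop))
      (Filter.Eventually.of_forall fun p => ?_)
    rw [Real.norm_of_nonneg (Real.rpow_nonneg (abs_nonneg _) _)]
    exact rpow_mid_le hρ _ _
  rw [← ofReal_integral_eq_lintegral_ofReal iZ (nn Z),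
    ← ofReal_integral_eq_lintegral_ofReal iY (nn Y),
    ENNReal.ofReal_le_ofReal_iff (integral_nonneg_of_ae (nn Z))] at hY
  rw [← ofReal_integral_eq_lintegral_ofReal iZ (nn Z),
    ← ofReal_integral_eq_lintegral_ofReal iM (nn (fun p => (Y p + Z p) / 2)),
    ENNReal.ofReal_le_ofReal_iff (integral_nonneg_of_ae (nn (fun p => (Y p + Z p) / 2)))] at hm
  have iS : Integrable (fun p => (|Y p| ^ ρ + |Z p| ^ ρ) / 2) I01 := (iY.add iZ).div_const 2
  have eS : ∫ p, (|Y p| ^ ρ + |Z p| ^ ρ) / 2 ∂I01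
      = ((∫ p, |Y p| ^ ρ ∂I01) + ∫ p, |Z p| ^ ρ ∂I01) / 2 := by
    rw [integral_div, integral_add iY iZ]
  have hle : (fun p => |(Y p + Z p) / 2| ^ ρ) ≤ᵐ[I01] fun p => (|Y p| ^ ρ + |Z p| ^ ρ) / 2 :=
    Filter.Eventually.of_forall fun p => rpow_mid_le hρ _ _
  have hI := integral_mono_ae iM iS hle
  have := (integral_eq_iff_of_ae_le iM iS hle).1 (by linarith)
  filter_upwards [this] with p hp
  by_contra hne
  exact absurd hp (rpow_mid_lt hρ hne).ne

lemma lintegral_call {f : ℝ → ℝ} (hf : Integrable f I01) (a : ℝ) :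
    ∫⁻ p, ENNReal.ofReal (f p - a) ∂I01 = ENNReal.ofReal (∫ p, max (f p - a) 0 ∂I01) := by
  have hp : Integrable (fun p => max (f p - a) 0) I01 := (hf.sub (integrable_const a)).pos_part
  rw [ofReal_integral_eq_lintegral_ofReal hp
    (Filter.Eventually.of_forall fun p => le_max_right _ _)]
  refine lintegral_congr fun p => ?_
  rw [ENNReal.ofReal_max]; simp

lemma call_mono {Z : ℝ → ℝ} (hZ : MonotoneOn Z (Ioo (0:ℝ) 1)) (hi : Integrable Z I01) (a : ℝ) :
    ∃ q ∈ Icc (0:ℝ) 1, ∫ p, max (Z p - a) 0 ∂I01 = (∫ p in Ioi q, Z p ∂I01) - a * (1 - q) := by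
  obtain ⟨q, hq, h⟩ := upper_set hZ a
  refine ⟨q, hq, ?_⟩
  rw [← setIntegral_sub_const hi a hq, ← integral_indicator measurableSet_Ioi]
  refine integral_congr_ae ?_
  filter_upwards [h] with p hp
  have hp' : (a < Z p) ↔ p ∈ Ioi q := iff_of_eq hp
  by_cases hpq : p ∈ Ioi q
  · rw [indicator_of_mem hpq, max_eq_left]
    linarith [hp'.2 hpq]
  · rw [indicator_of_notMem hpq, max_eq_right]
    have : ¬ a < Z p := fun h => hpq (hp'.1 h)
    linarith

lemma key_min {G ψ Z : ℝ → ℝ}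
    (hmin : ∀ a b : ℝ, (∀ q ∈ Icc (0:ℝ) 1, G q ≤ a + b * q) → ∀ q ∈ Icc (0:ℝ) 1, ψ q ≤ a + b * q)
    (hZ : MonotoneOn Z (Ioo (0:ℝ) 1)) (hi : Integrable Z I01)
    (hZψ : ∀ q ∈ Icc (0:ℝ) 1, ∫ p in Ioi q, Z p ∂I01 = ψ q)
    {U : ℝ → ℝ} (hU : Integrable U I01) (h0 : ∫ p, Z p ∂I01 = ∫ p, U p ∂I01)
    (hGU : ∀ q ∈ Icc (0:ℝ) 1, G q ≤ ∫ p in Ioi q, U p ∂I01) {ρ : ℝ} (hρ : 1 < ρ) :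
    ∫⁻ p, ENNReal.ofReal (|Z p| ^ ρ) ∂I01 ≤ ∫⁻ p, ENNReal.ofReal (|U p| ^ ρ) ∂I01 := by
  refine cx_transfer hi hU h0 (fun a => ?_) hρ
  rw [lintegral_call hi, lintegral_call hU]
  apply ENNReal.ofReal_le_ofReal
  obtain ⟨q, hq, e⟩ := call_mono hZ hi a
  rw [e, hZψ q hq]
  have := hmin ((∫ p, max (U p - a) 0 ∂I01) + a) (-a) (fun r hr => by
    have h1 := hGU r hr
    have h2 := tail_le_pos hU a hr
    linarith) q hq
  linarith

lemma quantile_map_mono {Q : ℝ → ℝ} (hQ : MonotoneOn Q (Ioo (0:ℝ) 1)) (hi : Integrable Q I01) :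
    IsProbabilityMeasure (I01.map Q) ∧ Integrable (fun x => x) (I01.map Q) ∧
      quantileFn (I01.map Q) =ᵐ[I01] Q := by
  have hm := mono_aem hQ
  have hP : IsProbabilityMeasure (I01.map Q) := Measure.isProbabilityMeasure_map hm
  have hI : Integrable (fun x => x) (I01.map Q) := by
    rw [integrable_map_measure (by fun_prop) hm]; exact hi
  refine ⟨hP, hI, ?_⟩
  have hle : quantileFn (I01.map Q) ≤ᵐ[I01] Q := by
    filter_upwards [ae_restrict_mem measurableSet_Ioo] with p hp
    rw [quantile_le_iff _ hp, Measure.real,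
      Measure.map_apply_of_aemeasurable hm measurableSet_Iic]
    have h1 : I01 (Iic p) ≤ I01 (Q ⁻¹' Iic (Q p)) := by
      apply measure_mono_ae
      filter_upwards [ae_restrict_mem measurableSet_Ioo] with r hr hrp
      exact hQ hr hp hrp
    rw [I01_Iic hp.1.le hp.2.le] at h1
    exact (ENNReal.ofReal_le_iff_le_toReal (measure_ne_top _ _)).1 h1
  refine (integral_eq_iff_of_ae_le (integrable_quantile _ hI) hi hle).1 ?_
  rw [mean_quantile, integral_map hm (by fun_prop)]

/-- for `μ, ν ∈ P_1(ℝ)` and `ψ̃` the concave hull of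
`q ↦ ∫_q^1 (F_μ^{-1}(p) - F_ν^{-1}(p)) dp` on `[0,1]`, there exists a probability measure
`ν_{P̄(μ)}` with `∫_q^1 F_{ν_{P̄(μ)}}^{-1}(p) dp = ψ̃(q) + ∫_q^1 F_ν^{-1}(p) dp` for all
`q ∈ [0,1]`; it satisfies `μ ≤cx ν_{P̄(μ)}` and, for each `ρ > 1` with `μ, ν ∈ P_ρ(ℝ)`,
it is the unique minimizer of `W_ρ(ν,·)` over `{η : μ ≤cx η}`. -/
theorem stmt13 (μ ν : Measure ℝ)
    [IsProbabilityMeasure μ] [IsProbabilityMeasure ν]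
    (hμ1 : Integrable (fun x => |x|) μ) (hν1 : Integrable (fun x => |x|) ν)
    (ψt : ℝ → ℝ)
    (hψconc : ConcaveOn ℝ (Icc 0 1) ψt)
    (hψge : ∀ q ∈ Icc (0:ℝ) 1, (∫ p in q..(1:ℝ), (quantileFn μ p - quantileFn ν p)) ≤ ψt q)
    (hψmin : ∀ χ : ℝ → ℝ, ConcaveOn ℝ (Icc 0 1) χ →
        (∀ q ∈ Icc (0:ℝ) 1, (∫ p in q..(1:ℝ), (quantileFn μ p - quantileFn ν p)) ≤ χ q) →
        ∀ q ∈ Icc (0:ℝ) 1, ψt q ≤ χ q) :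
    ∃ η : Measure ℝ, IsProbabilityMeasure η ∧
      (∀ q ∈ Icc (0:ℝ) 1,
          (∫ p in q..(1:ℝ), quantileFn η p) = ψt q + ∫ p in q..(1:ℝ), quantileFn ν p)
      ∧ ConvexOrder μ η
      ∧ (∀ ρ : ℝ, 1 < ρ → Integrable (fun x => |x| ^ ρ) μ → Integrable (fun x => |x| ^ ρ) ν →
          (Wp ρ ν η = ⨅ (η' : Measure ℝ) (_ : IsProbabilityMeasure η')
              (_ : ConvexOrder μ η'), Wp ρ ν η')
          ∧ ∀ η' : Measure ℝ, IsProbabilityMeasure η' → ConvexOrder μ η' →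
              Wp ρ ν η' = (⨅ (η'' : Measure ℝ) (_ : IsProbabilityMeasure η'')
                (_ : ConvexOrder μ η''), Wp ρ ν η'') → η' = η) := by
  have hμ : Integrable (fun x => x) μ :=
    (integrable_norm_iff (f := fun x : ℝ => x) (by fun_prop)).1 hμ1
  have hν : Integrable (fun x => x) ν :=
    (integrable_norm_iff (f := fun x : ℝ => x) (by fun_prop)).1 hν1
  have iμ := integrable_quantile μ hμ
  have iν := integrable_quantile ν hν
  have h00 : (0:ℝ) ∈ Icc (0:ℝ) 1 := by simp
  have h11 : (1:ℝ) ∈ Icc (0:ℝ) 1 := by simp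
  set G : ℝ → ℝ := fun q => ∫ p in q..(1:ℝ), (quantileFn μ p - quantileFn ν p) with hGdef
  have hGq : ∀ q ∈ Icc (0:ℝ) 1,
      G q = (∫ p in Ioi q, quantileFn μ p ∂I01) - ∫ p in Ioi q, quantileFn ν p ∂I01 := by
    intro q hq
    simp only [hGdef]
    rw [ii_eq _ hq, integral_sub iμ.integrableOn iν.integrableOn]
  have hGc : ContinuousOn G (Icc 0 1) := by
    have h1 : IntegrableOn (fun p => quantileFn μ p - quantileFn ν p) (Ioo 0 1) volume := iμ.sub iν
    rw [← integrableOn_Icc_iff_integrableOn_Ioo] at h1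
    have h2 := intervalIntegral.continuousOn_primitive_interval_left
      (f := fun p => quantileFn μ p - quantileFn ν p) (a := 0) (b := 1) (μ := volume)
      (by rwa [uIcc_of_le zero_le_one])
    rwa [uIcc_of_le zero_le_one] at h2
  have hG1 : G 1 = 0 := by simp [hGdef]
  have hmin : ∀ a b : ℝ, (∀ q ∈ Icc (0:ℝ) 1, G q ≤ a + b * q) →
      ∀ q ∈ Icc (0:ℝ) 1, ψt q ≤ a + b * q := by
    intro a b h
    refine hψmin (fun q => a + b * q) ⟨convex_Icc 0 1, fun x _ y _ s t _ _ hst => ?_⟩ h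
    simp only [smul_eq_mul]
    apply le_of_eq
    linear_combination a * hst
  obtain ⟨e0, e1, hψc⟩ := hull_cont hGc hψconc hψge hmin
  obtain ⟨Z, hZm, hZi, hZ⟩ := concave_deriv hψconc hψc
  have hZψ : ∀ q ∈ Icc (0:ℝ) 1, ∫ p in Ioi q, Z p ∂I01 = ψt q := by
    intro q hq
    rw [hZ q hq, e1, hG1, sub_zero]
  have hZ0 : ∫ p, Z p ∂I01 = (∫ x, x ∂μ) - ∫ x, x ∂ν := by
    have := hZψ 0 h00
    rw [e0, hGq 0 h00, restrict_Ioi_zero, mean_quantile, mean_quantile] at this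
    exact this
  let Q : ℝ → ℝ := fun p => Z p + quantileFn ν p
  have hQm : MonotoneOn Q (Ioo (0:ℝ) 1) := hZm.add (quantile_mono ν)
  have hQi : Integrable Q I01 := hZi.add iν
  obtain ⟨hηP, hηI, hηQ⟩ := quantile_map_mono hQm hQi
  set η := I01.map Q with hη
  have hηq : ∀ q ∈ Icc (0:ℝ) 1, ∫ p in Ioi q, quantileFn η p ∂I01
      = ψt q + ∫ p in Ioi q, quantileFn ν p ∂I01 := by
    intro q hq
    rw [integral_congr_ae (ae_restrict_of_ae hηQ), ← hZψ q hq]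
    exact integral_add hZi.integrableOn iν.integrableOn
  have hcx : ConvexOrder μ η := by
    refine convexOrder_of_quantile hμ hηI (fun q hq => ?_) ?_
    · rw [hηq q hq]
      have h1 := hψge q hq
      have h2 := hGq q hq
      simp only [hGdef] at h2
      linarith
    · have h1 := hηq 0 h00
      rw [restrict_Ioi_zero, mean_quantile, mean_quantile, e0, hGq 0 h00, restrict_Ioi_zero,
        mean_quantile, mean_quantile] at h1
      linarith
  refine ⟨η, hηP, fun q hq => ?_, hcx, fun ρ hρ hμρ hνρ => ?_⟩
  · rw [ii_eq _ hq, ii_eq _ hq]; exact hηq q hq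
  -- facts on the competitors
  have hcand : ∀ η' : Measure ℝ, IsProbabilityMeasure η' → Integrable (fun x => x) η' →
      ConvexOrder μ η' →
      ∫ p, Z p ∂I01 = ∫ p, (quantileFn η' p - quantileFn ν p) ∂I01 ∧
      ∀ q ∈ Icc (0:ℝ) 1, G q ≤ ∫ p in Ioi q, (quantileFn η' p - quantileFn ν p) ∂I01 := by
    intro η' hP hI h
    have iη' := integrable_quantile η' hI
    obtain ⟨hm, ho⟩ := of_convexOrder hμ hI h
    constructor
    · rw [integral_sub iη' iν, mean_quantile, mean_quantile, hZ0, hm]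
    · intro q hq
      rw [integral_sub iη'.integrableOn iν.integrableOn, hGq q hq]
      linarith [ho q hq]
  have hqη : qcost ρ ν η = ∫⁻ p, ENNReal.ofReal (|Z p| ^ ρ) ∂I01 := by
    unfold qcost
    refine lintegral_congr_ae ?_
    filter_upwards [hηQ] with p hp
    rw [hp]; simp [Q]
  have hle : ∀ η' : Measure ℝ, IsProbabilityMeasure η' → Integrable (fun x => x) η' →
      ConvexOrder μ η' → qcost ρ ν η ≤ qcost ρ ν η' := by
    intro η' hP hI h
    obtain ⟨c1, c2⟩ := hcand η' hP hI h
    rw [hqη]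
    exact key_min hmin hZm hZi hZψ ((integrable_quantile η' hI).sub iν) c1 c2 hρ
  have hcxμ : ConvexOrder μ μ := ⟨fun _ _ _ => le_rfl, fun _ _ _ => le_rfl⟩
  have hfin : qcost ρ ν η ≠ ∞ :=
    ne_top_of_le_ne_top (qcost_ne_top hρ hνρ hμρ) (hle μ inferInstance hμ hcxμ)
  have hW : Wp ρ ν η = ⨅ (η' : Measure ℝ) (_ : IsProbabilityMeasure η')
      (_ : ConvexOrder μ η'), Wp ρ ν η' := by
    apply le_antisymm
    · refine le_iInf fun η' => le_iInf fun hP => le_iInf fun h => ?_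
      by_cases ht : Wp ρ ν η' = ∞
      · rw [ht]; exact le_top
      · have hI := integrable_of_Wp hρ hν ht
        exact (Wp_le_qcost ρ ν η).trans ((hle η' hP hI h).trans (qcost_le_Wp hρ hν hI))
    · exact iInf_le_of_le η (iInf_le_of_le hηP (iInf_le_of_le hcx le_rfl))
  refine ⟨hW, fun η' hP h hWη' => ?_⟩
  rw [← hW] at hWη'
  have hWle : Wp ρ ν η' ≤ qcost ρ ν η := hWη'.le.trans (Wp_le_qcost ρ ν η)
  have hI := integrable_of_Wp hρ hν (ne_top_of_le_ne_top hfin hWle)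
  have hYle := (qcost_le_Wp hρ hν hI).trans hWle
  obtain ⟨c1, c2⟩ := hcand η' hP hI h
  have iY : Integrable (fun p => quantileFn η' p - quantileFn ν p) I01 :=
    (integrable_quantile η' hI).sub iν
  have iU : Integrable (fun p => ((quantileFn η' p - quantileFn ν p) + Z p) / 2) I01 :=
    (iY.add hZi).div_const 2
  have hkey := key_min hmin hZm hZi hZψ iU
    (by rw [integral_div, integral_add iY hZi, ← c1]; ring)
    (fun q hq => by
      rw [integral_div, integral_add iY.integrableOn hZi.integrableOn, hZψ q hq]
      have h1 := c2 q hq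
      have h2 : G q ≤ ψt q := hψge q hq
      linarith) hρ
  rw [hqη] at hfin hYle
  have hYZ := min_unique hρ iY.aemeasurable hZi.aemeasurable hfin hYle hkey
  rw [← map_quantile η', hη]
  refine Measure.map_congr ?_
  filter_upwards [hYZ] with p hp
  simp only [Q]
  linarith
end
end

section
/- Let ρ > 1 and μ, ν, μ_I, ν_J ∈ P_ρ(ℝ^d) with μ ≤cx ν. Then for any probability measure η⋆ with μ_I ≤cx η⋆ minimizing W_ρ(ν_J, η) over {η : μ_I ≤cx η}, one has W_ρ(η⋆, ν) ≤ W_ρ(μ, μ_I) + 2 W_ρ(ν, ν_J). -/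
open MeasureTheory ProbabilityTheory Set
open scoped ENNReal

noncomputable section

/-- Continuous linear images of bounded closed convex subsets of a Hilbert space are closed. -/
lemma closed_image_aux {H F : Type*} [NormedAddCommGroup H] [InnerProductSpace ℝ H]
    [CompleteSpace H] [NormedAddCommGroup F] [NormedSpace ℝ F] (T : H →L[ℝ] F) (C : Set H)
    (hconv : Convex ℝ C) (hcl : IsClosed C) (R : ℝ) (hR : ∀ x ∈ C, ‖x‖ ≤ R) :
    IsClosed (T '' C) := by
  rw [← closure_subset_iff_isClosed]
  intro t ht
  let K : ℕ → Set H := fun k => C ∩ T ⁻¹' (Metric.closedBall t (1 / ((k : ℝ) + 1)))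
  have hKne : ∀ k, (K k).Nonempty := by
    intro k
    obtain ⟨b, ⟨x, hx, rfl⟩, hb⟩ := Metric.mem_closure_iff.1 ht (1 / ((k : ℝ) + 1)) (by positivity)
    exact ⟨x, hx, by simpa [Metric.mem_closedBall, dist_comm] using hb.le⟩
  have hKcl : ∀ k, IsClosed (K k) := fun k =>
    hcl.inter (Metric.isClosed_closedBall.preimage T.continuous)
  have hKco : ∀ k, Convex ℝ (K k) := fun k =>
    hconv.inter ((convex_closedBall t _).linear_preimage T.toLinearMap)
  have hKanti : ∀ k l, k ≤ l → K l ⊆ K k := by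
    intro k l hkl x hx
    refine ⟨hx.1, Metric.closedBall_subset_closedBall ?_ hx.2⟩
    have : (k : ℝ) ≤ l := by exact_mod_cast hkl
    gcongr
  have hmin : ∀ k, ∃ v ∈ K k, ∀ w ∈ K k, ‖v‖ ≤ ‖w‖ := by
    intro k
    obtain ⟨v, hv, hv2⟩ := exists_norm_eq_iInf_of_complete_convex (hKne k) (hKcl k).isComplete
      (hKco k) 0
    refine ⟨v, hv, fun w hw => ?_⟩
    simp only [zero_sub, norm_neg] at hv2
    rw [hv2]
    exact ciInf_le ⟨0, by rintro _ ⟨w, rfl⟩; exact norm_nonneg _⟩ (⟨w, hw⟩ : K k)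
  choose x hxK hxmin using hmin
  have hmono : Monotone (fun k => ‖x k‖ ^ 2) := by
    intro k l hkl
    have := hxmin k (x l) (hKanti k l hkl (hxK l))
    dsimp only
    gcongr
  have hbdd : BddAbove (range (fun k => ‖x k‖ ^ 2)) := by
    refine ⟨R ^ 2, ?_⟩
    rintro _ ⟨k, rfl⟩
    have := hR _ (hxK k).1
    dsimp only
    gcongr
  have hcau := (tendsto_atTop_ciSup hmono hbdd).cauchySeq
  have hpar : ∀ k l, k ≤ l → ‖x k - x l‖ ^ 2 ≤ 2 * (‖x l‖ ^ 2 - ‖x k‖ ^ 2) := by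
    intro k l hkl
    have hmid : (1 / 2 : ℝ) • x k + (1 / 2 : ℝ) • x l ∈ K k :=
      hKco k (hxK k) (hKanti k l hkl (hxK l)) (by norm_num) (by norm_num) (by norm_num)
    have h1 := hxmin k _ hmid
    rw [← smul_add, norm_smul] at h1
    have h2 := parallelogram_law_with_norm ℝ (x k) (x l)
    norm_num at h1
    have h0 := norm_nonneg (x k)
    nlinarith
  have hxcau : CauchySeq x := by
    rw [Metric.cauchySeq_iff'] at hcau ⊢
    intro ε hε
    obtain ⟨N, hN⟩ := hcau (ε ^ 2 / 2) (by positivity)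
    refine ⟨N, fun n hn => ?_⟩
    have h1 := hN n hn
    rw [Real.dist_eq] at h1
    have h2 := hpar N n hn
    have h3 := le_abs_self (‖x n‖ ^ 2 - ‖x N‖ ^ 2)
    rw [dist_comm, dist_eq_norm]
    exact lt_of_pow_lt_pow_left₀ 2 hε.le (by linarith)
  obtain ⟨z, hz⟩ := cauchySeq_tendsto_of_complete hxcau
  have hzK : ∀ k, z ∈ K k := by
    intro k
    refine (hKcl k).mem_of_tendsto hz ?_
    filter_upwards [Filter.eventually_ge_atTop k] with l hl using hKanti k l hl (hxK l)
  refine ⟨z, (hzK 0).1, ?_⟩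
  rw [← dist_le_zero]
  exact ge_of_tendsto' tendsto_one_div_add_atTop_nhds_zero_nat fun k => (hzK k).2

lemma exists_measurable_argmax {E : Type*} [MeasurableSpace E] {n : ℕ} (hn : 0 < n)
    (g : Fin n → E → ℝ) (hg : ∀ i, Measurable (g i)) :
    ∃ c : E → Fin n, Measurable c ∧ ∀ y j, g j y ≤ g (c y) y := by
  classical
  have : Nonempty (Fin n) := ⟨⟨0, hn⟩⟩
  have hp : ∀ y, ∃ N : ℕ, ∃ h : N < n, ∀ j, g j y ≤ g ⟨N, h⟩ y := by
    intro y
    obtain ⟨i, hi⟩ := Finite.exists_max (fun i => g i y)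
    exact ⟨i, i.2, hi⟩
  have hm := measurable_find hp (by
    intro k
    by_cases h : k < n
    · simp only [h, exists_true_left, Set.ofPred_forall]
      exact MeasurableSet.iInter fun j => measurableSet_le (hg j) (hg _)
    · simp [h])
  refine ⟨fun y => ⟨Nat.find (hp y), (Nat.find_spec (hp y)).1⟩, ?_, fun y => (Nat.find_spec (hp y)).2⟩
  refine measurable_to_countable' fun i => ?_
  have : (fun y => (⟨Nat.find (hp y), (Nat.find_spec (hp y)).1⟩ : Fin n)) ⁻¹' {i}
      = (fun y => Nat.find (hp y)) ⁻¹' {(i : ℕ)} := by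
    ext y; simp [Fin.ext_iff]
  rw [this]
  exact hm (measurableSet_singleton _)
set_option linter.unusedSectionVars false

section finiteStrassen
variable {E : Type*} [NormedAddCommGroup E] [NormedSpace ℝ E] [FiniteDimensional ℝ E]
  [MeasurableSpace E] [BorelSpace E]

/-- The vector-valued map encoding a finite measurable partition. -/
def cellMap {n : ℕ} (c : E → Fin n) (y : E) : Fin n → ℝ × E := Pi.single (c y) ((1 : ℝ), y)

lemma cellMap_apply {n : ℕ} (c : E → Fin n) (y : E) (i : Fin n) :
    cellMap c y i = (c ⁻¹' {i}).indicator (fun y => ((1 : ℝ), y)) y := by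
  unfold cellMap
  by_cases h : c y = i
  · subst h; simp
  · rw [Pi.single_eq_of_ne (Ne.symm h)]; simp [h]

lemma integrable_pair (ν : Measure E) [IsProbabilityMeasure ν] (hν : Integrable (fun x => x) ν) :
    Integrable (fun y : E => ((1 : ℝ), y)) ν :=
  (integrable_const (1 : ℝ)).prodMk hν

lemma integrable_cellMap {n : ℕ} (c : E → Fin n) (hc : Measurable c)
    (ν : Measure E) [IsProbabilityMeasure ν] (hν : Integrable (fun x => x) ν) :
    Integrable (cellMap c) ν := by
  rw [integrable_pi_iff]
  intro i
  simp_rw [cellMap_apply]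
  exact (integrable_pair ν hν).indicator (hc (measurableSet_singleton i))

lemma exists_fractional_partition (μ ν : Measure E) [IsProbabilityMeasure μ]
    [IsProbabilityMeasure ν] (hμ : Integrable (fun x => x) μ) (hν : Integrable (fun x => x) ν)
    (hcx : ConvexOrder μ ν) {n : ℕ} (c : E → Fin n) (hc : Measurable c) :
    ∃ f : Fin n → E → ℝ, (∀ i, Measurable (f i)) ∧ (∀ i, 0 ≤ᵐ[ν] f i) ∧
      (∀ᵐ y ∂ν, ∑ i, f i y = 1) ∧
      ∀ i, ∫ y, f i y • ((1 : ℝ), y) ∂ν = ∫ x in c ⁻¹' {i}, ((1 : ℝ), x) ∂μ := by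
  classical
  have hn : 0 < n := (c 0).pos
  let h : E → NNReal := fun y => 1 + ‖y‖₊
  have hmeas : Measurable h := by fun_prop
  let m : Measure E := ν.withDensity fun y => (h y : ℝ≥0∞)
  have hνm : ν ≪ m := withDensity_absolutelyContinuous' (by fun_prop)
    (by filter_upwards with y; simp [h])
  have hmν : m ≪ ν := withDensity_absolutelyContinuous _ _
  have hfin : IsFiniteMeasure m := by
    refine isFiniteMeasure_withDensity ?_
    have : ∫⁻ y, (h y : ℝ≥0∞) ∂ν = 1 + ∫⁻ y, ‖y‖ₑ ∂ν := by
      simp only [h, ENNReal.coe_add, ENNReal.coe_one]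
      rw [lintegral_add_left measurable_const]
      simp [enorm]
    rw [this]
    exact ENNReal.add_ne_top.2 ⟨by simp, hν.2.ne⟩
  let w : E → ℝ × E := fun y => (h y : ℝ)⁻¹ • ((1 : ℝ), y)
  have hhpos : ∀ y, 0 < (h y : ℝ) := fun y => by simp only [h]; positivity
  have hw : MemLp w 2 m := by
    refine MemLp.of_bound ?_ 1 (Filter.Eventually.of_forall fun y => ?_)
    · have : Measurable w := by fun_prop
      exact this.aestronglyMeasurable
    · simp only [w, norm_smul, norm_inv, Real.norm_eq_abs, abs_of_pos (hhpos y)]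
      rw [inv_mul_le_one₀ (hhpos y)]
      simp [h, Prod.norm_def]
  have hint : ∀ f : E → ℝ, ∫ y, f y • w y ∂m = ∫ y, f y • ((1 : ℝ), y) ∂ν := by
    intro f
    rw [integral_withDensity_eq_integral_smul hmeas]
    congr 1; ext1 y
    simp only [w, NNReal.smul_def]
    rw [smul_comm (f y), smul_smul, mul_inv_cancel₀ (hhpos y).ne', one_smul]
  let S : Lp ℝ 2 m →L[ℝ] ℝ × E :=
    ((ContinuousLinearMap.lsmul ℝ ℝ : ℝ →L[ℝ] (ℝ × E) →L[ℝ] (ℝ × E)).lpPairing m 2 2).flip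
      (hw.toLp w)
  have hS : ∀ f : Lp ℝ 2 m, S f = ∫ y, f y • ((1 : ℝ), y) ∂ν := by
    intro f
    rw [← hint]
    simp only [S, ContinuousLinearMap.flip_apply, ContinuousLinearMap.lpPairing_eq_integral,
      ContinuousLinearMap.lsmul_apply]
    refine integral_congr_ae ?_
    filter_upwards [hw.coeFn_toLp] with y hy
    rw [hy]
  let H := PiLp 2 (fun _ : Fin n => Lp ℝ 2 m)
  let T : H →L[ℝ] (Fin n → ℝ × E) :=
    ContinuousLinearMap.pi fun i => S.comp (PiLp.proj 2 (fun _ : Fin n => Lp ℝ 2 m) i)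
  have hT : ∀ (F : H) i, T F i = ∫ y, F i y • ((1 : ℝ), y) ∂ν := fun F i => hS (F i)
  have hone : MemLp (fun _ : E => (1 : ℝ)) 2 m := memLp_const 1
  let C : Set H := {F | (∀ i, 0 ≤ F i) ∧ ∑ i, F i = hone.toLp _}
  have hCconv : Convex ℝ C := by
    rintro F ⟨hF1, hF2⟩ G ⟨hG1, hG2⟩ a b ha hb hab
    refine ⟨fun i => ?_, ?_⟩
    · have h1 : (a • F + b • G) i = a • F i + b • G i := rfl
      rw [h1]
      rw [← Lp.coeFn_nonneg]
      filter_upwards [Lp.coeFn_add (a • F i) (b • G i), Lp.coeFn_smul a (F i),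
        Lp.coeFn_smul b (G i), (Lp.coeFn_nonneg _).2 (hF1 i), (Lp.coeFn_nonneg _).2 (hG1 i)]
        with y h1 h2 h3 h4 h5
      rw [h1, Pi.add_apply, h2, h3]
      simp only [Pi.smul_apply, Pi.zero_apply, smul_eq_mul] at *
      positivity
    · have h1 : ∀ i, (a • F + b • G) i = a • F i + b • G i := fun i => rfl
      simp only [h1, Finset.sum_add_distrib, ← Finset.smul_sum, hF2, hG2]
      rw [← add_smul, hab, one_smul]
  have hcont : ∀ i, Continuous fun F : H => F i := fun i =>
    (PiLp.proj (𝕜 := ℝ) 2 (fun _ : Fin n => Lp ℝ 2 m) i).continuous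
  have hCcl : IsClosed C := by
    have hCeq : C = (⋂ i, {F : H | 0 ≤ F i}) ∩ {F : H | ∑ i, F i = hone.toLp _} := by
      ext F; simp [C]
    rw [hCeq]
    exact (isClosed_iInter fun i => isClosed_le continuous_const (hcont i)).inter
      (isClosed_eq (continuous_finsetSum _ fun i _ => hcont i) continuous_const)
  have hCbdd : ∀ F ∈ C, ‖F‖ ≤ √(∑ i : Fin n, ‖hone.toLp _‖ ^ 2) := by
    rintro F ⟨h1, h2⟩
    rw [PiLp.norm_eq_of_L2]
    gcongr with i
    refine norm_le_norm_of_abs_le_abs ?_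
    rw [abs_of_nonneg (h1 i), abs_of_nonneg (h2 ▸ Finset.sum_nonneg fun j _ => h1 j), ← h2]
    exact Finset.single_le_sum (f := fun j => F j) (fun j _ => h1 j) (Finset.mem_univ i)
  have hTC : IsClosed (T '' C) := closed_image_aux T C hCconv hCcl _ hCbdd
  let t : Fin n → ℝ × E := ∫ x, cellMap c x ∂μ
  have ht : ∀ i, t i = ∫ x in c ⁻¹' {i}, ((1 : ℝ), x) ∂μ := by
    intro i
    have hI := integrable_cellMap c hc μ hμ
    rw [integrable_pi_iff] at hI
    simp only [t]
    rw [eval_integral hI]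
    simp_rw [cellMap_apply]
    rw [integral_indicator (hc (measurableSet_singleton i))]
  have key : t ∈ T '' C := by
    by_contra hnot
    obtain ⟨l, u, hl1, hl2⟩ := geometric_hahn_banach_closed_point
      (hCconv.linear_image T.toLinearMap) hTC hnot
    let g : Fin n → E → ℝ := fun i y => l (Pi.single i ((1 : ℝ), y))
    have hgc : ∀ i, Continuous (g i) := fun i =>
      l.continuous.comp ((continuous_single i).comp (by fun_prop))
    obtain ⟨c', hc', hmax⟩ := exists_measurable_argmax hn g (fun i => (hgc i).measurable)
    let M : E → ℝ := fun y => l (cellMap c' y)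
    have hMconv : ConvexOn ℝ univ M := by
      refine ⟨convex_univ, fun x _ y _ a b ha hb hab => ?_⟩
      have haff : ∀ k, g k (a • x + b • y) = a * g k x + b * g k y := by
        intro k
        simp only [g]
        rw [← smul_eq_mul, ← smul_eq_mul, ← map_smul, ← map_smul, ← map_add]
        congr 1
        rw [← Pi.single_smul, ← Pi.single_smul, ← Pi.single_add]
        congr 1
        simp [hab]
      have h1 : M (a • x + b • y) = g (c' (a • x + b • y)) (a • x + b • y) := rfl
      rw [h1, haff, smul_eq_mul, smul_eq_mul]
      exact add_le_add (mul_le_mul_of_nonneg_left (hmax x _) ha)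
        (mul_le_mul_of_nonneg_left (hmax y _) hb)
    have hMμ : Integrable M μ := l.integrable_comp (integrable_cellMap c' hc' μ hμ)
    have hMν : Integrable M ν := l.integrable_comp (integrable_cellMap c' hc' ν hν)
    have hle := hcx.2 M hMconv (hMμ.add_measure hMν)
    have hlt : l t = ∫ x, l (cellMap c x) ∂μ :=
      (l.integral_comp_comm (integrable_cellMap c hc μ hμ)).symm
    have hle2 : l t ≤ ∫ x, M x ∂μ := by
      rw [hlt]
      exact integral_mono (l.integrable_comp (integrable_cellMap c hc μ hμ)) hMμ
        (fun x => hmax x (c x))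
    have hBm : ∀ i, MeasurableSet (c' ⁻¹' {i}) := fun i => hc' (measurableSet_singleton i)
    let F : H := WithLp.toLp 2 fun i => indicatorConstLp 2 (hBm i) (measure_ne_top m _) (1 : ℝ)
    have hFi : ∀ i, F i =ᵐ[m] (c' ⁻¹' {i}).indicator (fun _ => (1 : ℝ)) := fun i =>
      indicatorConstLp_coeFn (hs := hBm i) (hμs := measure_ne_top m _)
    have hFC : F ∈ C := by
      refine ⟨fun i => ?_, ?_⟩
      · rw [← Lp.coeFn_nonneg]
        filter_upwards [hFi i] with y hy
        rw [hy]
        exact indicator_nonneg (fun _ _ => zero_le_one) y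
      · refine Lp.ext ?_
        filter_upwards [hone.coeFn_toLp, Lp.coeFn_finsetSum Finset.univ (fun i => F i),
          ae_all_iff.2 hFi] with y h1 h2 h3
        rw [h1, h2]
        simp [h3, Finset.sum_apply, indicator_apply]
    have hTF : T F = ∫ y, cellMap c' y ∂ν := by
      ext1 i
      have hI := integrable_cellMap c' hc' ν hν
      rw [integrable_pi_iff] at hI
      rw [hT, eval_integral hI]
      refine integral_congr_ae ?_
      filter_upwards [hνm.ae_eq (hFi i)] with y hy
      rw [hy, cellMap_apply]
      by_cases hh : y ∈ c' ⁻¹' {i}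
      · simp [hh]
      · simp [hh]
    have h3 := hl1 (T F) ⟨F, hFC, rfl⟩
    rw [hTF, ← l.integral_comp_comm (integrable_cellMap c' hc' ν hν)] at h3
    change ∫ y, M y ∂ν < u at h3
    linarith
  obtain ⟨F, ⟨hF1, hF2⟩, hF3⟩ := key
  refine ⟨fun i => F i, fun i => (Lp.stronglyMeasurable (F i)).measurable,
    fun i => hνm.ae_le ((Lp.coeFn_nonneg _).2 (hF1 i)), ?_, fun i => ?_⟩
  · refine hνm.ae_le ?_
    filter_upwards [hone.coeFn_toLp, Lp.coeFn_finsetSum Finset.univ (fun i => F i)] with y h1 h2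
    rw [hF2, h1] at h2
    simpa [Finset.sum_apply] using h2.symm
  · rw [← ht, ← hF3, hT]

end finiteStrassen

lemma exists_family {E : Type*} [NormedAddCommGroup E] [NormedSpace ℝ E] [FiniteDimensional ℝ E]
    [MeasurableSpace E] [BorelSpace E] (μ ν : Measure E) [IsProbabilityMeasure μ]
    [IsProbabilityMeasure ν] (hμ : Integrable (fun x => x) μ) (hν : Integrable (fun x => x) ν)
    (hcx : ConvexOrder μ ν) {n : ℕ} (c : E → Fin n) (hc : Measurable c) :
    ∃ κ : Fin n → Measure E, (∀ i, IsProbabilityMeasure (κ i)) ∧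
      (∀ i, Integrable (fun x => x) (κ i)) ∧ (∑ i, μ (c ⁻¹' {i}) • κ i = ν) ∧
      ∀ i, μ.real (c ⁻¹' {i}) • ∫ y, y ∂(κ i) = ∫ x in c ⁻¹' {i}, x ∂μ := by
  classical
  obtain ⟨f, hfm, hf0, hf1, hf⟩ := exists_fractional_partition μ ν hμ hν hcx c hc
  have hle : ∀ i, ∀ᵐ y ∂ν, ‖f i y‖ ≤ 1 := by
    intro i
    filter_upwards [ae_all_iff.2 hf0, hf1] with y h0 h1
    rw [Real.norm_eq_abs, abs_of_nonneg (h0 i), ← h1]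
    exact Finset.single_le_sum (f := fun j => f j y) (fun j _ => h0 j) (Finset.mem_univ i)
  have hfint : ∀ i, Integrable (f i) ν := fun i =>
    Integrable.of_bound (hfm i).aestronglyMeasurable 1 (hle i)
  have hfy : ∀ i, Integrable (fun y => f i y • y) ν := fun i =>
    hν.bdd_smul 1 (hfm i).aestronglyMeasurable (hle i)
  have hfst : ∀ i, ∫ y, f i y ∂ν = μ.real (c ⁻¹' {i}) := by
    intro i
    have h1 := congrArg Prod.fst (hf i)
    simp only [Prod.smul_mk, smul_eq_mul, mul_one] at h1
    rw [fst_integral ((hfint i).prodMk (hfy i)),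
      fst_integral (integrable_pair μ hμ).integrableOn] at h1
    simpa [Measure.real] using h1
  have hsnd : ∀ i, ∫ y, f i y • y ∂ν = ∫ x in c ⁻¹' {i}, x ∂μ := by
    intro i
    have h1 := congrArg Prod.snd (hf i)
    simp only [Prod.smul_mk, smul_eq_mul, mul_one] at h1
    rw [snd_integral ((hfint i).prodMk (hfy i)),
      snd_integral (integrable_pair μ hμ).integrableOn] at h1
    exact h1
  have hmass : ∀ i, ∫⁻ y, ENNReal.ofReal (f i y) ∂ν = μ (c ⁻¹' {i}) := by
    intro i
    rw [← ofReal_integral_eq_lintegral_ofReal (hfint i) (hf0 i), hfst]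
    simp
  let w : Fin n → Measure E := fun i => ν.withDensity fun y => ENNReal.ofReal (f i y)
  let κ : Fin n → Measure E := fun i =>
    if μ (c ⁻¹' {i}) = 0 then Measure.dirac 0 else (μ (c ⁻¹' {i}))⁻¹ • w i
  have hwu : ∀ i, w i univ = μ (c ⁻¹' {i}) := fun i => by
    simp only [w]
    rw [withDensity_apply _ MeasurableSet.univ, Measure.restrict_univ, hmass]
  have hκ : ∀ i, μ (c ⁻¹' {i}) • κ i = w i := by
    intro i
    by_cases h : μ (c ⁻¹' {i}) = 0
    · rw [h, zero_smul, eq_comm, ← Measure.measure_univ_eq_zero, hwu, h]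
    · simp only [κ, h, if_false]
      rw [smul_smul, ENNReal.mul_inv_cancel h (measure_ne_top _ _), one_smul]
  have hwint : ∀ i, Integrable (fun x => x) (w i) := by
    intro i
    rw [integrable_withDensity_iff_integrable_smul' (by fun_prop) (by simp)]
    refine (hfy i).congr ?_
    filter_upwards [hf0 i] with y hy
    rw [ENNReal.toReal_ofReal hy]
  refine ⟨κ, fun i => ?_, fun i => ?_, ?_, fun i => ?_⟩
  · by_cases h : μ (c ⁻¹' {i}) = 0
    · simp only [κ, h, if_true]; infer_instance
    · refine ⟨?_⟩
      simp only [κ, h, if_false, Measure.smul_apply, smul_eq_mul, hwu]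
      exact ENNReal.inv_mul_cancel h (measure_ne_top _ _)
  · by_cases h : μ (c ⁻¹' {i}) = 0
    · simp only [κ, h, if_true]
      exact integrable_dirac (by simp)
    · simp only [κ, h, if_false]
      exact (hwint i).smul_measure (by simp [h])
  · simp_rw [hκ]
    ext s hs
    simp only [w, Measure.coe_finsetSum, Finset.sum_apply, withDensity_apply _ hs]
    rw [← lintegral_finsetSum _ (fun i _ => by fun_prop)]
    have : ∫⁻ y in s, ∑ i, ENNReal.ofReal (f i y) ∂ν = ∫⁻ y in s, 1 ∂ν := by
      refine lintegral_congr_ae (ae_restrict_of_ae ?_)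
      filter_upwards [ae_all_iff.2 hf0, hf1] with y h0 h1
      rw [← ENNReal.ofReal_sum_of_nonneg (fun i _ => h0 i), h1, ENNReal.ofReal_one]
    rw [this]; simp
  · rw [← hsnd, Measure.real, ← integral_smul_measure, hκ]
    simp only [w]
    rw [integral_withDensity_eq_integral_toReal_smul (by fun_prop) (by simp)]
    refine integral_congr_ae ?_
    filter_upwards [hf0 i] with y hy
    rw [ENNReal.toReal_ofReal hy]

lemma Wp_rpow {E : Type*} [NormedAddCommGroup E] [MeasurableSpace E]
    (ρ : ℝ) (hρ : 0 < ρ) (μ ν : Measure E) :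
    (Wp ρ μ ν) ^ (1 / ρ) = ⨅ (π : Measure (E × E)) (_ : π.map Prod.fst = μ)
      (_ : π.map Prod.snd = ν), (∫⁻ p, ‖p.1 - p.2‖ₑ ^ ρ ∂π) ^ (1 / ρ) := by
  have h := fun x : E => (ENNReal.ofReal_rpow_of_nonneg (norm_nonneg x) hρ.le).symm
  have h2 : ∀ x : ℝ≥0∞, x ^ (1 / ρ) = ENNReal.orderIsoRpow (1 / ρ) (by positivity) x :=
    fun x => rfl
  simp only [Wp, h, ofReal_norm, h2, OrderIso.map_iInf]

lemma Wp_comm_le {E : Type*} [NormedAddCommGroup E] [MeasurableSpace E] [BorelSpace E]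
    [SecondCountableTopology E] (ρ : ℝ) (μ ν : Measure E) :
    Wp ρ μ ν ≤ Wp ρ ν μ := by
  unfold Wp
  refine le_iInf fun π => le_iInf fun h1 => le_iInf fun h2 => ?_
  refine iInf_le_of_le (π.map Prod.swap) (iInf_le_of_le ?_ (iInf_le_of_le ?_ ?_))
  · rw [Measure.map_map measurable_fst measurable_swap]; exact h2
  · rw [Measure.map_map measurable_snd measurable_swap]; exact h1
  · rw [lintegral_map (by fun_prop) measurable_swap]
    simp [norm_sub_rev]

lemma Wp_comm {E : Type*} [NormedAddCommGroup E] [MeasurableSpace E] [BorelSpace E]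
    [SecondCountableTopology E] (ρ : ℝ) (μ ν : Measure E) :
    Wp ρ μ ν = Wp ρ ν μ := le_antisymm (Wp_comm_le ρ μ ν) (Wp_comm_le ρ ν μ)

lemma exists_gluing {E : Type*} [MeasurableSpace E] [StandardBorelSpace E] [Nonempty E]
    (μ : Measure E) [IsProbabilityMeasure μ] (π₁ π₂ : Measure (E × E))
    (h₁ : π₁.map Prod.fst = μ) (h₂ : π₂.map Prod.fst = μ) :
    ∃ γ : Measure (E × E × E), γ.map (fun p => (p.1, p.2.1)) = π₁ ∧
      γ.map (fun p => (p.1, p.2.2)) = π₂ := by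
  have hp : ∀ π : Measure (E × E), π.map Prod.fst = μ → IsProbabilityMeasure π := by
    intro π h
    rw [← Measure.isProbabilityMeasure_map_iff (μ := π) (f := Prod.fst) measurable_fst.aemeasurable, h]
    infer_instance
  have := hp _ h₁
  have := hp _ h₂
  refine ⟨μ ⊗ₘ (π₁.condKernel ×ₖ π₂.condKernel), ?_, ?_⟩
  · have := π₁.disintegrate π₁.condKernel
    rw [Measure.fst, h₁] at this
    conv_rhs => rw [← this]
    ext s hs
    rw [Measure.map_apply (by fun_prop) hs, Measure.compProd_apply (by measurability),
      Measure.compProd_apply hs]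
    refine lintegral_congr fun x => ?_
    have h3 := Kernel.fst_prod π₁.condKernel π₂.condKernel
    conv_rhs => rw [← h3]
    rw [Kernel.fst_apply' _ _ (measurable_prodMk_left hs)]
    rfl
  · have := π₂.disintegrate π₂.condKernel
    rw [Measure.fst, h₂] at this
    conv_rhs => rw [← this]
    ext s hs
    rw [Measure.map_apply (by fun_prop) hs, Measure.compProd_apply (by measurability),
      Measure.compProd_apply hs]
    refine lintegral_congr fun x => ?_
    have h3 := Kernel.snd_prod π₁.condKernel π₂.condKernel
    conv_rhs => rw [← h3]
    rw [Kernel.snd_apply' _ _ (measurable_prodMk_left hs)]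
    rfl

lemma Wp_triangle {E : Type*} [NormedAddCommGroup E] [MeasurableSpace E] [BorelSpace E]
    [SecondCountableTopology E] [StandardBorelSpace E] (ρ : ℝ) (hρ : 1 < ρ)
    (a b c : Measure E) [IsProbabilityMeasure b] :
    (Wp ρ a c) ^ (1 / ρ) ≤ (Wp ρ a b) ^ (1 / ρ) + (Wp ρ b c) ^ (1 / ρ) := by
  have hρ0 : 0 < ρ := by linarith
  rw [Wp_comm ρ a b, Wp_rpow ρ hρ0 b a, Wp_rpow ρ hρ0 b c]
  simp only [ENNReal.iInf_add, ENNReal.add_iInf]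
  refine le_iInf fun π₂ => le_iInf fun h3 => le_iInf fun h4 => le_iInf fun π₁ => le_iInf fun h1 =>
    le_iInf fun h2 => ?_
  obtain ⟨γ, g1, g2⟩ := exists_gluing b π₁ π₂ h1 h3
  rw [Wp_rpow ρ hρ0]
  refine iInf_le_of_le (γ.map Prod.snd) (iInf_le_of_le ?_ (iInf_le_of_le ?_ ?_))
  · rw [Measure.map_map measurable_fst measurable_snd, ← h2, ← g1,
      Measure.map_map measurable_snd (by fun_prop)]
    rfl
  · rw [Measure.map_map measurable_snd measurable_snd, ← h4, ← g2,
      Measure.map_map measurable_snd (by fun_prop)]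
    rfl
  rw [← g1, ← g2, lintegral_map (by fun_prop) (by fun_prop),
    lintegral_map (by fun_prop) (by fun_prop), lintegral_map (by fun_prop) (by fun_prop)]
  refine le_trans ?_ (ENNReal.lintegral_Lp_add_le (μ := γ) (p := ρ)
    (f := fun p => ‖p.1 - p.2.1‖ₑ) (g := fun p => ‖p.1 - p.2.2‖ₑ) (by fun_prop) (by fun_prop) hρ.le)
  gcongr with p
  simp only [Pi.add_apply]
  rw [enorm_sub_rev p.1 p.2.1]
  refine le_trans (le_of_eq ?_) (enorm_add_le _ _)
  congr 1; abel

section construction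
variable {E : Type*} [NormedAddCommGroup E] [NormedSpace ℝ E] [FiniteDimensional ℝ E]
  [MeasurableSpace E] [BorelSpace E]

lemma integrable_id_of_rpow (ρ : ℝ) (hρ : 1 < ρ) (μ : Measure E) [IsProbabilityMeasure μ]
    (h : Integrable (fun x => ‖x‖ ^ ρ) μ) : Integrable (fun x => x) μ := by
  refine ((integrable_const (1 : ℝ)).add h).mono' (by fun_prop)
    (Filter.Eventually.of_forall fun x => ?_)
  simp only [Pi.add_apply]
  rcases le_total ‖x‖ 1 with h1 | h1
  · have := Real.rpow_nonneg (norm_nonneg x) ρ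
    linarith
  · have := Real.rpow_le_rpow_of_exponent_le h1 hρ.le
    rw [Real.rpow_one] at this
    linarith

lemma jensen_shift (κ : Measure E) [IsProbabilityMeasure κ] (hκ : Integrable (fun x => x) κ)
    (φ : E → ℝ) (hφ : ConvexOn ℝ univ φ) (z : E)
    (hint : Integrable (fun y => φ (y + z - ∫ x, x ∂κ)) κ) :
    φ z ≤ ∫ y, φ (y + z - ∫ x, x ∂κ) ∂κ := by
  have hcont : ContinuousOn φ univ := hφ.continuousOn isOpen_univ
  have hi : Integrable (fun y => y + z - ∫ x, x ∂κ) κ :=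
    (hκ.add (integrable_const z)).sub (integrable_const _)
  have := hφ.map_integral_le (μ := κ) (f := fun y => y + z - ∫ x, x ∂κ) hcont isClosed_univ
    (by simp) hi hint
  have hi2 : Integrable (fun y => y + z) κ := hκ.add (integrable_const z)
  rw [integral_sub hi2 (integrable_const _), integral_add hκ (integrable_const z)] at this
  simpa using this

lemma jensen_shift_lintegral (κ : Measure E) [IsProbabilityMeasure κ]
    (hκ : Integrable (fun x => x) κ)
    (φ : E → ℝ) (hφ : ConvexOn ℝ univ φ) (h0 : ∀ x, 0 ≤ φ x) (z : E) :
    ENNReal.ofReal (φ z) ≤ ∫⁻ y, ENNReal.ofReal (φ (y + z - ∫ x, x ∂κ)) ∂κ := by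
  have hcont : Continuous φ := continuousOn_univ.1 (hφ.continuousOn isOpen_univ)
  by_cases hint : Integrable (fun y => φ (y + z - ∫ x, x ∂κ)) κ
  · rw [← ofReal_integral_eq_lintegral_ofReal hint (Filter.Eventually.of_forall fun y => h0 _)]
    exact ENNReal.ofReal_le_ofReal (jensen_shift κ hκ φ hφ z hint)
  · have hm : AEStronglyMeasurable (fun y => φ (y + z - ∫ x, x ∂κ)) κ :=
      (hcont.comp (by fun_prop)).aestronglyMeasurable
    have : ∫⁻ y, ENNReal.ofReal (φ (y + z - ∫ x, x ∂κ)) ∂κ = ∞ := by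
      by_contra hne
      exact hint ((lintegral_ofReal_ne_top_iff_integrable hm
        (Filter.Eventually.of_forall fun y => h0 _)).1 hne)
    rw [this]
    exact le_top

lemma lintegral_cells (μ : Measure E) {n : ℕ} (c : E → Fin n) (hc : Measurable c)
    (f : E → ℝ≥0∞) (hf : Measurable f) :
    ∫⁻ x, f x ∂μ = ∑ i, ∫⁻ x in c ⁻¹' {i}, f x ∂μ := by
  classical
  have hm := fun i => hc (measurableSet_singleton i)
  have h1 : ∀ i, ∫⁻ x in c ⁻¹' {i}, f x ∂μ = ∫⁻ x, (c ⁻¹' {i}).indicator f x ∂μ :=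
    fun i => (lintegral_indicator (hm i) f).symm
  simp only [h1]
  rw [← lintegral_finsetSum _ (fun i _ => hf.indicator (hm i))]
  refine lintegral_congr fun x => ?_
  simp [indicator_apply]

lemma cell_bound (ρ : ℝ) (hρ : 1 < ρ) (μ : Measure E) [IsProbabilityMeasure μ]
    (hμ : Integrable (fun x => x) μ) (A : Set E) (v m : E)
    (hm : μ.real A • m = ∫ x in A, x ∂μ) :
    ‖m - v‖ₑ ^ ρ * μ A ≤ ∫⁻ x in A, ‖x - v‖ₑ ^ ρ ∂μ := by
  by_cases hp : μ A = 0
  · simp [hp]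
  have hpt : μ A ≠ ∞ := measure_ne_top _ _
  have hρ0 : 0 < ρ := by linarith
  have h1 : μ.real A • (m - v) = ∫ x in A, (x - v) ∂μ := by
    rw [integral_sub hμ.integrableOn (integrable_const v), smul_sub, hm]
    simp
  have h2 : μ A * ‖m - v‖ₑ ≤ ∫⁻ x in A, ‖x - v‖ₑ ∂μ := by
    have h3 := enorm_integral_le_lintegral_enorm (μ := μ.restrict A) (fun x => x - v)
    rw [← h1, enorm_smul] at h3
    convert h3 using 2
    rw [Measure.real, Real.enorm_eq_ofReal ENNReal.toReal_nonneg, ENNReal.ofReal_toReal hpt]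
  have h4 := eLpNorm_le_eLpNorm_mul_rpow_measure_univ (μ := μ.restrict A)
    (f := fun x => x - v) (p := 1) (q := ENNReal.ofReal ρ)
    (by rw [← ENNReal.ofReal_one]; exact ENNReal.ofReal_le_ofReal hρ.le) (by fun_prop)
  rw [eLpNorm_one_eq_lintegral_enorm, eLpNorm_eq_lintegral_rpow_enorm_toReal (by simpa using hρ0)
    (by simp)] at h4
  simp only [ENNReal.toReal_ofReal hρ0.le, Measure.restrict_apply_univ, ENNReal.toReal_one] at h4
  have h5 := ENNReal.rpow_le_rpow (h2.trans h4) hρ0.le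
  rw [ENNReal.mul_rpow_of_nonneg _ _ hρ0.le, ENNReal.mul_rpow_of_nonneg _ _ hρ0.le,
    ← ENNReal.rpow_mul, ← ENNReal.rpow_mul, one_div_mul_cancel hρ0.ne', ENNReal.rpow_one] at h5
  have h6 : (1 / 1 - 1 / ρ) * ρ = ρ - 1 := by field_simp
  have h7 : μ A ^ ρ = μ A ^ (ρ - 1) * μ A := by
    conv_rhs => rw [← ENNReal.rpow_one (μ A), ← ENNReal.rpow_mul, ← ENNReal.rpow_add _ _ hp hpt]
    congr 1; ring
  rw [h6, h7] at h5
  have h8 : μ A ^ (ρ - 1) ≠ 0 := by simp [ENNReal.rpow_eq_zero_iff, hp, hpt]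
  have h9 : μ A ^ (ρ - 1) ≠ ∞ := ENNReal.rpow_ne_top_of_nonneg (by linarith) hpt
  rw [← ENNReal.mul_le_mul_iff_right h8 h9]
  calc _ = μ A ^ (ρ - 1) * μ A * ‖m - v‖ₑ ^ ρ := by ring
    _ ≤ _ := h5
    _ = _ := by ring

lemma exists_cells (ρ : ℝ) (hρ : 1 < ρ) (μ : Measure E) [IsProbabilityMeasure μ]
    (hμ : Integrable (fun x => ‖x‖ ^ ρ) μ) (ε : ℝ≥0∞) (hε : ε ≠ 0) :
    ∃ (n : ℕ) (c : E → Fin n) (v : Fin n → E), Measurable c ∧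
      (∫⁻ x, ‖x - v (c x)‖ₑ ^ ρ ∂μ) ^ (1 / ρ) ≤ ε := by
  have hρ0 : 0 < ρ := by linarith
  have hmem : MemLp (fun x : E => x) (ENNReal.ofReal ρ) μ := by
    rw [← integrable_norm_rpow_iff (by fun_prop) (by simpa using hρ0) (by simp)]
    simpa [ENNReal.toReal_ofReal hρ0.le] using hμ
  obtain ⟨s, hs, -⟩ := hmem.exists_simpleFunc_eLpNorm_sub_lt (by simp) hε
  let e := s.range.equivFin
  refine ⟨_, fun x => e ⟨s x, s.mem_range_self x⟩, fun i => (e.symm i : E), ?_, ?_⟩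
  · refine measurable_to_countable' fun i => ?_
    have : (fun x => e ⟨s x, s.mem_range_self x⟩) ⁻¹' {i} = s ⁻¹' {(e.symm i : E)} := by
      ext x
      simp only [mem_preimage, mem_singleton_iff]
      rw [← Equiv.eq_symm_apply, Subtype.ext_iff]
    rw [this]
    exact s.measurableSet_fiber _
  · rw [eLpNorm_eq_lintegral_rpow_enorm_toReal (by simpa using hρ0) (by simp)] at hs
    simpa [ENNReal.toReal_ofReal hρ0.le] using hs.le

lemma exists_dominating (ρ : ℝ) (hρ : 1 < ρ) (μ ν μI : Measure E) [IsProbabilityMeasure μ]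
    [IsProbabilityMeasure ν] [IsProbabilityMeasure μI]
    (hμρ : Integrable (fun x => ‖x‖ ^ ρ) μ) (hνρ : Integrable (fun x => ‖x‖ ^ ρ) ν)
    (hcx : ConvexOrder μ ν) (π : Measure (E × E)) (h1 : π.map Prod.fst = μ)
    (h2 : π.map Prod.snd = μI) (ε : ℝ≥0∞) (hε : ε ≠ 0) :
    ∃ η : Measure E, IsProbabilityMeasure η ∧ ConvexOrder μI η ∧
      (Wp ρ ν η) ^ (1 / ρ) ≤ (∫⁻ p, ‖p.1 - p.2‖ₑ ^ ρ ∂π) ^ (1 / ρ) + ε := by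
  have hρ0 : 0 < ρ := by linarith
  have hμ := integrable_id_of_rpow ρ hρ μ hμρ
  have hν := integrable_id_of_rpow ρ hρ ν hνρ
  have hπ : IsProbabilityMeasure π := by
    rw [← Measure.isProbabilityMeasure_map_iff (μ := π) (f := Prod.fst)
      measurable_fst.aemeasurable, h1]
    infer_instance
  obtain ⟨n, c, v, hc, hv⟩ := exists_cells ρ hρ μ hμρ (ε / 2) (by simp [hε])
  obtain ⟨κ, hκp, hκi, hκν, hκm⟩ := exists_family μ ν hμ hν hcx c hc
  let K : Kernel (E × E) E := (Kernel.ofFunOfCountable κ).comap (fun p => c p.1) (by fun_prop)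
  have hK : ∀ p, K p = κ (c p.1) := fun p => rfl
  have hKM : IsMarkovKernel K := ⟨fun p => by rw [hK]; infer_instance⟩
  let m : Fin n → E := fun i => ∫ y, y ∂(κ i)
  have hmm : Measurable m := Measurable.of_discrete
  have hvm : Measurable v := Measurable.of_discrete
  let Θ : Measure ((E × E) × E) := π ⊗ₘ K
  let Z : (E × E) × E → E := fun q => q.2 + q.1.2 - m (c q.1.1)
  have hZ : Measurable Z := by fun_prop
  have hΘ1 : Θ.map Prod.fst = π := Measure.fst_compProd π K
  have hΘ2 : Θ.map Prod.snd = ν := by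
    ext B hB
    rw [Measure.map_apply measurable_snd hB, Measure.compProd_apply (measurable_snd hB)]
    have hg : Measurable (fun i => κ i B) := Measurable.of_discrete
    have e1 : ∫⁻ p, K p (Prod.mk p ⁻¹' (Prod.snd ⁻¹' B)) ∂π = ∫⁻ x, κ (c x) B ∂μ := by
      rw [← h1, lintegral_map (by fun_prop) measurable_fst]
      rfl
    rw [e1, ← lintegral_map (f := fun i => κ i B) hg hc, lintegral_fintype]
    conv_rhs => rw [← hκν]
    simp only [Measure.coe_finsetSum, Finset.sum_apply, Measure.smul_apply, smul_eq_mul]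
    refine Finset.sum_congr rfl fun i _ => ?_
    rw [Measure.map_apply hc (measurableSet_singleton i), mul_comm]
  refine ⟨Θ.map Z, Measure.isProbabilityMeasure_map hZ.aemeasurable, ⟨?_, ?_⟩, ?_⟩
  · intro φ hφ h0
    have hcont : Continuous φ := continuousOn_univ.1 (hφ.continuousOn isOpen_univ)
    have hφm : Measurable φ := hcont.measurable
    rw [← h2, lintegral_map (by fun_prop) measurable_snd, lintegral_map (by fun_prop) hZ,
      Measure.lintegral_compProd (by fun_prop)]
    exact lintegral_mono fun p => jensen_shift_lintegral (κ (c p.1)) (hκi _) φ hφ h0 p.2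
  · intro φ hφ hint
    have hcont : Continuous φ := continuousOn_univ.1 (hφ.continuousOn isOpen_univ)
    have hi1 : Integrable φ (π.map Prod.snd) := h2 ▸ hint.left_of_add_measure
    have hi2 := hint.right_of_add_measure
    rw [integrable_map_measure hcont.aestronglyMeasurable hZ.aemeasurable] at hi2
    rw [integrable_map_measure hcont.aestronglyMeasurable measurable_snd.aemeasurable] at hi1
    rw [← h2, integral_map measurable_snd.aemeasurable hcont.aestronglyMeasurable,
      integral_map hZ.aemeasurable hcont.aestronglyMeasurable]
    have hi4 := Measure.integral_compProd hi2
    simp only [Function.comp_def] at hi4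
    rw [hi4]
    have hi3 := (Measure.integrable_compProd_iff hi2.aestronglyMeasurable).1 hi2
    refine integral_mono_ae hi1 (Integrable.integral_compProd hi2) ?_
    filter_upwards [hi3.1] with p hp
    exact jensen_shift (κ (c p.1)) (hκi _) φ hφ p.2 hp
  · rw [Wp_rpow ρ hρ0]
    have hG : Measurable (fun q : (E × E) × E => (q.2, Z q)) := by fun_prop
    refine iInf_le_of_le (Θ.map fun q => (q.2, Z q)) (iInf_le_of_le ?_ (iInf_le_of_le ?_ ?_))
    · rw [Measure.map_map measurable_fst hG]; exact hΘ2
    · rw [Measure.map_map measurable_snd hG]; rfl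
    rw [lintegral_map (by fun_prop) hG]
    have e1 : ∫⁻ q, ‖(q.2, Z q).1 - (q.2, Z q).2‖ₑ ^ ρ ∂Θ
        = ∫⁻ p, ‖m (c p.1) - p.2‖ₑ ^ ρ ∂π := by
      conv_rhs => rw [← hΘ1]
      rw [lintegral_map (by fun_prop) measurable_fst]
      refine lintegral_congr fun q => ?_
      simp only [Z]
      congr 2; abel
    have e2 : ∫⁻ p : E × E, ‖p.1 - v (c p.1)‖ₑ ^ ρ ∂π = ∫⁻ x, ‖x - v (c x)‖ₑ ^ ρ ∂μ := by
      rw [← h1, lintegral_map (by fun_prop) measurable_fst]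
    have e3 : ∫⁻ p, ‖m (c p.1) - v (c p.1)‖ₑ ^ ρ ∂π = ∫⁻ x, ‖m (c x) - v (c x)‖ₑ ^ ρ ∂μ := by
      rw [← h1, lintegral_map (by fun_prop) measurable_fst]
    have e4 : ∫⁻ x, ‖m (c x) - v (c x)‖ₑ ^ ρ ∂μ ≤ ∫⁻ x, ‖x - v (c x)‖ₑ ^ ρ ∂μ := by
      rw [lintegral_cells μ c hc _ (by fun_prop), lintegral_cells μ c hc _ (by fun_prop)]
      refine Finset.sum_le_sum fun i _ => ?_
      have hA := hc (measurableSet_singleton i)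
      have a1 : ∫⁻ x in c ⁻¹' {i}, ‖m (c x) - v (c x)‖ₑ ^ ρ ∂μ
          = ‖m i - v i‖ₑ ^ ρ * μ (c ⁻¹' {i}) := by
        rw [← setLIntegral_const]
        refine setLIntegral_congr_fun hA fun x hx => ?_
        have : c x = i := hx
        simp only [this]
      have a2 : ∫⁻ x in c ⁻¹' {i}, ‖x - v (c x)‖ₑ ^ ρ ∂μ
          = ∫⁻ x in c ⁻¹' {i}, ‖x - v i‖ₑ ^ ρ ∂μ := by
        refine setLIntegral_congr_fun hA fun x hx => ?_
        have : c x = i := hx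
        simp only [this]
      rw [a1, a2]
      exact cell_bound ρ hρ μ hμ _ _ _ (hκm i)
    rw [e1]
    have m1 := ENNReal.lintegral_Lp_add_le (μ := π) (p := ρ)
      (f := fun p : E × E => ‖p.1 - p.2‖ₑ)
      (g := fun p : E × E => ‖m (c p.1) - v (c p.1)‖ₑ + ‖p.1 - v (c p.1)‖ₑ) (by fun_prop) (by fun_prop) hρ.le
    have m2 := ENNReal.lintegral_Lp_add_le (μ := π) (p := ρ)
      (f := fun p : E × E => ‖m (c p.1) - v (c p.1)‖ₑ) (g := fun p : E × E => ‖p.1 - v (c p.1)‖ₑ)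
      (by fun_prop) (by fun_prop) hρ.le
    rw [e3, e2] at m2
    have m3 : (∫⁻ p, ‖m (c p.1) - p.2‖ₑ ^ ρ ∂π) ^ (1 / ρ) ≤
        (∫⁻ p, ((fun p : E × E => ‖p.1 - p.2‖ₑ) +
          (fun p : E × E => ‖m (c p.1) - v (c p.1)‖ₑ + ‖p.1 - v (c p.1)‖ₑ)) p ^ ρ ∂π) ^ (1 / ρ) := by
      gcongr with p
      simp only [Pi.add_apply]
      calc ‖m (c p.1) - p.2‖ₑ
          = ‖(p.1 - p.2) + ((m (c p.1) - v (c p.1)) + (v (c p.1) - p.1))‖ₑ := by congr 1; abel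
        _ ≤ ‖p.1 - p.2‖ₑ + (‖m (c p.1) - v (c p.1)‖ₑ + ‖v (c p.1) - p.1‖ₑ) :=
            (enorm_add_le _ _).trans (by gcongr; exact enorm_add_le _ _)
        _ = _ := by rw [enorm_sub_rev (v (c p.1)) p.1]
    refine m3.trans (m1.trans ?_)
    gcongr
    refine m2.trans ?_
    calc _ ≤ ε / 2 + ε / 2 := by
          refine add_le_add (le_trans ?_ hv) hv
          gcongr
      _ = ε := ENNReal.add_halves ε

end construction

/-- for `ρ > 1`, `μ, ν, μ_I, ν_J ∈ P_ρ(ℝ^d)` with `μ ≤cx ν`, any minimizer `η⋆`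
of `W_ρ(ν_J, ·)` over `{η : μ_I ≤cx η}` satisfies
`W_ρ(η⋆, ν) ≤ W_ρ(μ, μ_I) + 2 W_ρ(ν, ν_J)`. -/
theorem stmt14 {d : ℕ} (ρ : ℝ) (hρ : 1 < ρ)
    (μ ν μI νJ : Measure (EuclideanSpace ℝ (Fin d)))
    [IsProbabilityMeasure μ] [IsProbabilityMeasure ν]
    [IsProbabilityMeasure μI] [IsProbabilityMeasure νJ]
    (hμρ : Integrable (fun x => ‖x‖ ^ ρ) μ) (hνρ : Integrable (fun x => ‖x‖ ^ ρ) ν)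
    (hμIρ : Integrable (fun x => ‖x‖ ^ ρ) μI) (hνJρ : Integrable (fun x => ‖x‖ ^ ρ) νJ)
    (hcx : ConvexOrder μ ν)
    (ηs : Measure (EuclideanSpace ℝ (Fin d))) [IsProbabilityMeasure ηs]
    (hηscx : ConvexOrder μI ηs)
    (hηsmin : Wp ρ νJ ηs = ⨅ (η : Measure (EuclideanSpace ℝ (Fin d)))
        (_ : IsProbabilityMeasure η) (_ : ConvexOrder μI η), Wp ρ νJ η) :
    (Wp ρ ηs ν) ^ (1 / ρ) ≤ (Wp ρ μ μI) ^ (1 / ρ) + 2 * (Wp ρ ν νJ) ^ (1 / ρ) := by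
  have hρ0 : 0 < ρ := by linarith
  have key : (Wp ρ νJ ηs) ^ (1 / ρ) ≤ (Wp ρ μ μI) ^ (1 / ρ) + (Wp ρ ν νJ) ^ (1 / ρ) := by
    rw [Wp_rpow ρ hρ0 μ μI]
    simp only [ENNReal.iInf_add]
    refine le_iInf fun π => le_iInf fun h1 => le_iInf fun h2 => ?_
    refine ENNReal.le_of_forall_pos_le_add fun ε hε _ => ?_
    obtain ⟨η, hη, hηcx, hηW⟩ := exists_dominating ρ hρ μ ν μI hμρ hνρ hcx π h1 h2 ε
      (by simpa using hε.ne')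
    have hle : Wp ρ νJ ηs ≤ Wp ρ νJ η := by
      rw [hηsmin]
      exact iInf_le_of_le η (iInf_le_of_le hη (iInf_le_of_le hηcx le_rfl))
    calc (Wp ρ νJ ηs) ^ (1 / ρ) ≤ (Wp ρ νJ η) ^ (1 / ρ) := by gcongr
      _ ≤ (Wp ρ νJ ν) ^ (1 / ρ) + (Wp ρ ν η) ^ (1 / ρ) := Wp_triangle ρ hρ νJ ν η
      _ ≤ (Wp ρ ν νJ) ^ (1 / ρ) + ((∫⁻ p, ‖p.1 - p.2‖ₑ ^ ρ ∂π) ^ (1 / ρ) + ε) := by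
          rw [Wp_comm ρ νJ ν]; gcongr
      _ = _ := by ring
  calc (Wp ρ ηs ν) ^ (1 / ρ) ≤ (Wp ρ ηs νJ) ^ (1 / ρ) + (Wp ρ νJ ν) ^ (1 / ρ) :=
        Wp_triangle ρ hρ ηs νJ ν
    _ = (Wp ρ νJ ηs) ^ (1 / ρ) + (Wp ρ ν νJ) ^ (1 / ρ) := by
        rw [Wp_comm ρ ηs νJ, Wp_comm ρ νJ ν]
    _ ≤ ((Wp ρ μ μI) ^ (1 / ρ) + (Wp ρ ν νJ) ^ (1 / ρ)) + (Wp ρ ν νJ) ^ (1 / ρ) := by gcongr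
    _ = _ := by ring
end
end

section
/- Let f, g : [0,1] → ℝ be two convex functions and let h be the convex hull of f − g, i.e. the largest convex function on [0,1] bounded from above by f − g. Then f − h is convex on [0,1]. -/
open Set

/-- Convexity on `[0,1]` through affine majorants. -/
theorem convexOn_iff_affine (φ : ℝ → ℝ) : ConvexOn ℝ (Icc 0 1) φ ↔
    ∀ u v w c d : ℝ, 0 ≤ u → v ≤ 1 → u ≤ w → w ≤ v → φ u ≤ c * u + d → φ v ≤ c * v + d →
      φ w ≤ c * w + d := by
  constructor
  · intro hφ u v w c d hu hv huw hwv h1 h2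
    rcases (huw.trans hwv).eq_or_lt with h | h
    · have : w = u := by linarith
      rw [this]; exact h1
    have hp : 0 < v - u := by linarith
    have ha : 0 ≤ (v - w) / (v - u) := div_nonneg (by linarith) hp.le
    have hb : 0 ≤ (w - u) / (v - u) := div_nonneg (by linarith) hp.le
    have hab : (v - w) / (v - u) + (w - u) / (v - u) = 1 := by field_simp; ring
    have hw : (v - w) / (v - u) * u + (w - u) / (v - u) * v = w := by field_simp; ring
    have := hφ.2 (x := u) (y := v) ⟨hu, by linarith⟩ ⟨by linarith, hv⟩ ha hb hab
    simp only [smul_eq_mul] at this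
    rw [hw] at this
    generalize (v - w) / (v - u) = a at *
    generalize (w - u) / (v - u) = b at *
    have e1 := mul_le_mul_of_nonneg_left h1 ha
    have e2 := mul_le_mul_of_nonneg_left h2 hb
    have : c * w + d = a * (c * u + d) + b * (c * v + d) := by
      rw [← hw]; linear_combination (-d) * hab
    linarith
  · intro H
    refine LinearOrder.convexOn_of_lt (convex_Icc 0 1) ?_
    intro u hu v hv huv a b ha hb hab
    have hp : v - u ≠ 0 := by linarith
    simp only [smul_eq_mul]
    have hb' : b = 1 - a := by linarith
    subst hb'
    have := H u v (a * u + (1 - a) * v) ((φ v - φ u) / (v - u))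
      (φ u - (φ v - φ u) / (v - u) * u) hu.1 hv.2 (by nlinarith) (by nlinarith)
      (by linarith) (le_of_eq (by field_simp; ring))
    refine this.trans (le_of_eq ?_)
    field_simp
    ring

theorem stmt17 (f g h : ℝ → ℝ)
    (hf : ConvexOn ℝ (Icc 0 1) f) (hg : ConvexOn ℝ (Icc 0 1) g)
    (hh : ConvexOn ℝ (Icc 0 1) h)
    (hle : ∀ x ∈ Icc (0:ℝ) 1, h x ≤ f x - g x)
    (hmax : ∀ h' : ℝ → ℝ, ConvexOn ℝ (Icc 0 1) h' →
        (∀ x ∈ Icc (0:ℝ) 1, h' x ≤ f x - g x) → ∀ x ∈ Icc (0:ℝ) 1, h' x ≤ h x) :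
    ConvexOn ℝ (Icc 0 1) (fun x => f x - h x) := by
  classical
  rw [convexOn_iff_affine] at hf hg hh ⊢
  intro x y z c d hx hy hxz hzy h1 h2
  -- the competitor: raise `h` to `f - L` on `[x,y]`
  let k : ℝ → ℝ := fun t => if x ≤ t ∧ t ≤ y then max (h t) (f t - (c * t + d)) else h t
  have hk : ∀ t, h t ≤ k t := by
    intro t; simp only [k]; split_ifs
    · exact le_max_left _ _
    · exact le_rfl
  have hkf : ∀ t, x ≤ t → t ≤ y → f t - (c * t + d) ≤ k t := by
    intro t a b; simp only [k]; rw [if_pos ⟨a, b⟩]; exact le_max_right _ _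
  have hk' : ∀ t m, h t ≤ m → (x ≤ t → t ≤ y → f t - (c * t + d) ≤ m) → k t ≤ m := by
    intro t m a b; simp only [k]; split_ifs with H
    · exact max_le a (b H.1 H.2)
    · exact a
  have hkz := hmax k ?_ ?_ z ⟨by linarith, by linarith⟩
  · have := hkf z hxz hzy
    linarith
  · rw [convexOn_iff_affine]
    intro u v w a b hu hv huw hwv e1 e2
    have hl : ∀ t, u ≤ t → t ≤ v → h t ≤ a * t + b := fun t p q =>
      hh u v t a b hu hv p q ((hk u).trans e1) ((hk v).trans e2)
    refine hk' w _ (hl w huw hwv) ?_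
    intro hxw hwy
    have A : f (max u x) ≤ (a + c) * max u x + (b + d) := by
      rcases le_total u x with p | p
      · rw [max_eq_right p]
        have := hl x p (by linarith)
        linarith
      · rw [max_eq_left p]
        have := hkf u p (by linarith)
        linarith
    have B : f (min v y) ≤ (a + c) * min v y + (b + d) := by
      rcases le_total v y with p | p
      · rw [min_eq_left p]
        have := hkf v (by linarith) p
        linarith
      · rw [min_eq_right p]
        have := hl y (by linarith) p
        linarith
    have := hf (max u x) (min v y) w (a + c) (b + d) (le_max_of_le_left hu)
      (min_le_of_left_le hv) (max_le huw hxw) (le_min hwv hwy) A B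
    linarith
  · intro t ht
    refine hk' t _ (hle t ht) ?_
    intro p q
    have g1 := hle x ⟨hx, by linarith⟩
    have g2 := hle y ⟨by linarith, hy⟩
    have := hg x y t c d hx hy p q (by linarith) (by linarith)
    linarith
end

section
/- Let f : (0,1) → ℝ be a non-decreasing function and let η be the image of the Lebesgue measure on (0,1) under f (the law of f(U) with U uniform on (0,1)). Then f and the quantile function F_η^{-1} coincide away from the at most countable set of their common discontinuities; if moreover f is left-continuous, then f(p) = F_η^{-1}(p) for every p ∈ (0,1). -/
open MeasureTheory Set
open scoped ENNReal

noncomputable section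

theorem quantile_aux (f : ℝ → ℝ) (hf : MonotoneOn f (Ioo 0 1))
    (η : Measure ℝ) (hη : η = (volume.restrict (Ioo (0:ℝ) 1)).map f) :
    (∀ p ∈ Ioo (0:ℝ) 1, quantileFn η p ≤ f p) ∧
    (∀ q ∈ Ioo (0:ℝ) 1, ∀ p ∈ Ioo (0:ℝ) 1, q < p → f q ≤ quantileFn η p) := by
  have hm : AEMeasurable f (volume.restrict (Ioo (0:ℝ) 1)) :=
    aemeasurable_restrict_of_monotoneOn measurableSet_Ioo hf
  have hval : ∀ x, η (Iic x) = volume (f ⁻¹' (Iic x) ∩ Ioo (0:ℝ) 1) := by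
    intro x
    rw [hη, Measure.map_apply_of_aemeasurable hm measurableSet_Iic,
      Measure.restrict_apply₀' measurableSet_Ioo.nullMeasurableSet]
  have hlow : ∀ q ∈ Ioo (0:ℝ) 1, ∀ p ∈ Ioo (0:ℝ) 1, q < p →
      ∀ x, p ≤ (η (Iic x)).toReal → f q ≤ x := by
    intro q hq p hp hqp x hx
    by_contra hc
    push Not at hc
    have hsub : f ⁻¹' (Iic x) ∩ Ioo (0:ℝ) 1 ⊆ Ioo 0 q := by
      rintro r ⟨hr, hr'⟩
      refine ⟨hr'.1, ?_⟩
      by_contra h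
      push Not at h
      have h1 := hf hq hr' h
      have h2 : f r ≤ x := hr
      linarith
    have h3 : (η (Iic x)).toReal ≤ (volume (Ioo 0 q)).toReal := by
      rw [hval]
      exact ENNReal.toReal_mono (by simp) (measure_mono hsub)
    rw [Real.volume_Ioo, ENNReal.toReal_ofReal (by linarith [hq.1])] at h3
    linarith
  have hmem : ∀ p ∈ Ioo (0:ℝ) 1, p ≤ (η (Iic (f p))).toReal := by
    intro p hp
    have hsub : Ioc 0 p ⊆ f ⁻¹' (Iic (f p)) ∩ Ioo (0:ℝ) 1 := by
      intro r hr
      have hr' : r ∈ Ioo (0:ℝ) 1 := ⟨hr.1, hr.2.trans_lt hp.2⟩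
      exact ⟨hf hr' hp hr.2, hr'⟩
    have hfin : volume (f ⁻¹' (Iic (f p)) ∩ Ioo (0:ℝ) 1) ≠ ∞ :=
      ne_top_of_le_ne_top (b := volume (Ioo (0:ℝ) 1)) (by simp) (measure_mono inter_subset_right)
    have h3 := ENNReal.toReal_mono hfin (measure_mono hsub)
    rw [Real.volume_Ioc, ENNReal.toReal_ofReal (by linarith [hp.1]), ← hval] at h3
    linarith
  refine ⟨fun p hp => ?_, fun q hq p hp hqp => ?_⟩
  · have h2 : p / 2 ∈ Ioo (0:ℝ) 1 := ⟨by linarith [hp.1], by linarith [hp.1, hp.2]⟩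
    exact csInf_le ⟨f (p / 2), fun x hx => hlow _ h2 p hp (by linarith [hp.1]) x hx⟩ (hmem p hp)
  · exact le_csInf ⟨f p, hmem p hp⟩ (fun x hx => hlow q hq p hp hqp x hx)

/-- if `f : (0,1) → ℝ` is non-decreasing and `η` is the image of the Lebesgue
measure on `(0,1)` by `f` (the law of `f(U)`, `U` uniform on `(0,1)`), then `f` and the
quantile function of `η` coincide away from the at most countable set of their common
discontinuities; if moreover `f` is left-continuous, they coincide everywhere on `(0,1)`. -/
theorem stmt18 (f : ℝ → ℝ) (hf : MonotoneOn f (Ioo 0 1))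
    (η : Measure ℝ) (hη : η = (volume.restrict (Ioo (0:ℝ) 1)).map f) :
    (Set.Countable {p ∈ Ioo (0:ℝ) 1 |
        ¬ ContinuousWithinAt f (Ioo 0 1) p ∧ ¬ ContinuousWithinAt (quantileFn η) (Ioo 0 1) p}
      ∧ ∀ p ∈ Ioo (0:ℝ) 1,
          (ContinuousWithinAt f (Ioo 0 1) p ∨ ContinuousWithinAt (quantileFn η) (Ioo 0 1) p) →
          f p = quantileFn η p)
    ∧ ((∀ p ∈ Ioo (0:ℝ) 1, ContinuousWithinAt f (Ioo 0 p) p) →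
        ∀ p ∈ Ioo (0:ℝ) 1, f p = quantileFn η p) := by
  obtain ⟨hle, hge⟩ := quantile_aux f hf η hη
  have hleft : ∀ p ∈ Ioo (0:ℝ) 1, ContinuousWithinAt f (Ioo 0 p) p → f p = quantileFn η p := by
    intro p hp hc
    refine le_antisymm ?_ (hle p hp)
    have hne : (nhdsWithin p (Ioo 0 p)).NeBot := by
      rw [← mem_closure_iff_nhdsWithin_neBot, closure_Ioo hp.1.ne]
      exact ⟨hp.1.le, le_rfl⟩
    refine le_of_tendsto hc ?_
    filter_upwards [self_mem_nhdsWithin] with q hq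
    exact hge q ⟨hq.1, hq.2.trans hp.2⟩ p hp hq.2
  refine ⟨⟨?_, ?_⟩, fun h p hp => hleft p hp (h p hp)⟩
  · refine Set.Countable.mono ?_ hf.countable_not_continuousWithinAt
    exact fun p hp => ⟨hp.1, hp.2.1⟩
  · rintro p hp (hc | hc)
    · exact hleft p hp (hc.mono (Ioo_subset_Ioo_right hp.2.le))
    · refine le_antisymm ?_ (hle p hp)
      have hne : (nhdsWithin p (Ioo p 1)).NeBot := by
        rw [← mem_closure_iff_nhdsWithin_neBot, closure_Ioo hp.2.ne]
        exact ⟨le_rfl, hp.2.le⟩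
      refine ge_of_tendsto (hc.mono (Ioo_subset_Ioo_left hp.1.le)) ?_
      filter_upwards [self_mem_nhdsWithin] with r hr
      exact hge p hp r ⟨hp.1.trans hr.1, hr.2⟩ hr.1
end
end

section
/- Let ρ > 1 and η, η₁, η₂ ∈ P_ρ(ℝ^d). Then W_ρ(η, (η₁+η₂)/2)^ρ ≤ (W_ρ(η,η₁)^ρ + W_ρ(η,η₂)^ρ)/2. Moreover, when η is absolutely continuous with respect to the Lebesgue measure on ℝ^d, or when d = 1 and η has no atom, equality holds if and only if η₁ = η₂. -/
open MeasureTheory Set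
open scoped ENNReal

noncomputable section

section Existence

open Filter Topology
open scoped NNReal

variable {E : Type*} [NormedAddCommGroup E] [InnerProductSpace ℝ E] [FiniteDimensional ℝ E]
  [MeasurableSpace E] [BorelSpace E]

lemma lsc_cost {X : Type*} [TopologicalSpace X] [MeasurableSpace X] [OpensMeasurableSpace X]
    (c : X → ℝ) (hc : Continuous c) :
    LowerSemicontinuous (fun π : ProbabilityMeasure X => ∫⁻ p, ENNReal.ofReal (c p) ∂(π : Measure X)) := by
  have key : (fun π : ProbabilityMeasure X => ∫⁻ p, ENNReal.ofReal (c p) ∂(π : Measure X))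
      = fun π : ProbabilityMeasure X => ⨆ n : ℕ,
        ∫⁻ p, ((min (Real.toNNReal (c p)) n : ℝ≥0) : ℝ≥0∞) ∂(π : Measure X) := by
    funext π
    rw [← lintegral_iSup]
    · refine lintegral_congr fun p => ?_
      apply le_antisymm
      · obtain ⟨n, hn⟩ := exists_nat_ge (Real.toNNReal (c p))
        refine le_iSup_of_le n ?_
        rw [min_eq_left hn]
        rfl
      · refine iSup_le fun n => ?_
        change _ ≤ ((Real.toNNReal (c p) : ℝ≥0) : ℝ≥0∞)
        exact_mod_cast min_le_left _ _
    · intro n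
      have : Continuous fun p => ((min (Real.toNNReal (c p)) n : ℝ≥0) : ℝ≥0∞) := by fun_prop
      exact this.measurable
    · intro m n hmn p
      simp only
      gcongr
  rw [key]
  refine lowerSemicontinuous_iSup fun n => Continuous.lowerSemicontinuous ?_
  let f : BoundedContinuousFunction X ℝ≥0 := BoundedContinuousFunction.mkOfBound
    ⟨fun p => min (Real.toNNReal (c p)) n, by fun_prop⟩ n (by
      intro p q
      have h1 : min (Real.toNNReal (c p)) n ≤ (n : ℝ≥0) := min_le_right _ _
      have h2 : min (Real.toNNReal (c q)) n ≤ (n : ℝ≥0) := min_le_right _ _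
      have h1' : ((min (Real.toNNReal (c p)) n : ℝ≥0) : ℝ) ≤ n := by exact_mod_cast h1
      have h2' : ((min (Real.toNNReal (c q)) n : ℝ≥0) : ℝ) ≤ n := by exact_mod_cast h2
      have h3 := (min (Real.toNNReal (c p)) n : ℝ≥0).2
      have h4 := (min (Real.toNNReal (c q)) n : ℝ≥0).2
      rw [NNReal.dist_eq, abs_le]
      constructor
      · simp only [ContinuousMap.coe_mk]
        linarith [show (0:ℝ) ≤ ((min (Real.toNNReal (c p)) n : ℝ≥0) : ℝ) from h3]
      · simp only [ContinuousMap.coe_mk]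
        linarith [show (0:ℝ) ≤ ((min (Real.toNNReal (c q)) n : ℝ≥0) : ℝ) from h4])
  exact ProbabilityMeasure.continuous_lintegral_boundedContinuousFunction f

lemma isCompact_couplings (μ ν : Measure E) [IsProbabilityMeasure μ] [IsProbabilityMeasure ν] :
    IsCompact {π : ProbabilityMeasure (E × E) | (π : Measure (E × E)).map Prod.fst = μ ∧
      (π : Measure (E × E)).map Prod.snd = ν} := by
  set S := {π : ProbabilityMeasure (E × E) | (π : Measure (E × E)).map Prod.fst = μ ∧
      (π : Measure (E × E)).map Prod.snd = ν} with hS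
  have hcl : IsClosed S := by
    have : S = {π : ProbabilityMeasure (E × E) |
        π.map (continuous_fst.measurable.aemeasurable) = (⟨μ, inferInstance⟩ : ProbabilityMeasure E)} ∩
        {π : ProbabilityMeasure (E × E) |
        π.map (continuous_snd.measurable.aemeasurable) = (⟨ν, inferInstance⟩ : ProbabilityMeasure E)} := by
      ext π
      exact and_congr ⟨fun h => Subtype.ext h, fun h => congrArg Subtype.val h⟩
        ⟨fun h => Subtype.ext h, fun h => congrArg Subtype.val h⟩
    rw [this]
    exact (isClosed_eq (ProbabilityMeasure.continuous_map continuous_fst) continuous_const).inter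
      (isClosed_eq (ProbabilityMeasure.continuous_map continuous_snd) continuous_const)
  rw [← hcl.closure_eq]
  apply isCompact_closure_of_isTightMeasureSet
  rw [isTightMeasureSet_iff_exists_isCompact_measure_compl_le]
  intro ε hε
  have h1 := isTightMeasureSet_singleton (μ := μ)
  have h2 := isTightMeasureSet_singleton (μ := ν)
  rw [isTightMeasureSet_iff_exists_isCompact_measure_compl_le] at h1 h2
  obtain ⟨K, hK, hK'⟩ := h1 (ε / 2) (ENNReal.half_pos hε.ne')
  obtain ⟨L, hL, hL'⟩ := h2 (ε / 2) (ENNReal.half_pos hε.ne')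
  refine ⟨K ×ˢ L, hK.prod hL, ?_⟩
  rintro _ ⟨π, ⟨hπ1, hπ2⟩, rfl⟩
  have e1 : (π : Measure (E × E)) (Prod.fst ⁻¹' Kᶜ) ≤ ε / 2 := by
    rw [← Measure.map_apply measurable_fst hK.measurableSet.compl, hπ1]
    exact hK' _ rfl
  have e2 : (π : Measure (E × E)) (Prod.snd ⁻¹' Lᶜ) ≤ ε / 2 := by
    rw [← Measure.map_apply measurable_snd hL.measurableSet.compl, hπ2]
    exact hL' _ rfl
  calc (π : Measure (E × E)) (K ×ˢ L)ᶜ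
      ≤ (π : Measure (E × E)) (Prod.fst ⁻¹' Kᶜ ∪ Prod.snd ⁻¹' Lᶜ) := by
        apply measure_mono
        intro p hp
        simp only [mem_compl_iff, mem_prod, not_and_or] at hp
        exact hp
    _ ≤ _ := measure_union_le _ _
    _ ≤ ε / 2 + ε / 2 := add_le_add e1 e2
    _ = ε := ENNReal.add_halves ε

lemma exists_opt (c : E × E → ℝ) (hc : Continuous c)
    (μ ν : Measure E) [IsProbabilityMeasure μ] [IsProbabilityMeasure ν] :
    ∃ π : Measure (E × E), π.map Prod.fst = μ ∧ π.map Prod.snd = ν ∧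
      ∀ π' : Measure (E × E), π'.map Prod.fst = μ → π'.map Prod.snd = ν →
        ∫⁻ p, ENNReal.ofReal (c p) ∂π ≤ ∫⁻ p, ENNReal.ofReal (c p) ∂π' := by
  obtain ⟨π, ⟨h1, h2⟩, hπ⟩ := LowerSemicontinuousOn.exists_isMinOn
    (s := {π : ProbabilityMeasure (E × E) | (π : Measure (E × E)).map Prod.fst = μ ∧
      (π : Measure (E × E)).map Prod.snd = ν})
    ⟨⟨μ.prod ν, inferInstance⟩, by simp, by simp⟩
    (isCompact_couplings μ ν) ((lsc_cost c hc).lowerSemicontinuousOn _)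
  refine ⟨π, h1, h2, fun π' h1' h2' => ?_⟩
  have hp : IsProbabilityMeasure π' := by
    constructor
    have : π'.map Prod.fst univ = 1 := by rw [h1']; simp
    rwa [Measure.map_apply measurable_fst MeasurableSet.univ] at this
  exact hπ (show (⟨π', hp⟩ : ProbabilityMeasure (E × E)) ∈ _ from ⟨h1', h2'⟩)

end Existence

section TwoMono

lemma two_mono_ae {E : Type*} [MeasurableSpace E] (π : Measure (E × E)) [IsProbabilityMeasure π]
    (c : E × E → ℝ≥0∞) (hc : Measurable c) (hfin : ∫⁻ p, c p ∂π ≠ ∞)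
    (hopt : ∀ π' : Measure (E × E), π'.map Prod.fst = π.map Prod.fst →
      π'.map Prod.snd = π.map Prod.snd → ∫⁻ p, c p ∂π ≤ ∫⁻ p, c p ∂π') :
    (π.prod π) {q | c (q.1.1, q.2.2) + c (q.2.1, q.1.2) < c q.1 + c q.2} = 0 := by
  classical
  set S : Set ((E × E) × (E × E)) :=
    {q | c (q.1.1, q.2.2) + c (q.2.1, q.1.2) < c q.1 + c q.2} with hSdef
  have hS : MeasurableSet S := measurableSet_lt (by fun_prop) (by fun_prop)
  have hswap : MeasurePreserving (Prod.swap : (E × E) × (E × E) → _) (π.prod π) (π.prod π) :=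
    Measure.measurePreserving_swap
  have hSswap : Prod.swap ⁻¹' S = S := by
    ext q
    simp only [hSdef, mem_preimage, mem_ofPred_eq, Prod.fst_swap, Prod.snd_swap]
    rw [add_comm (c q.2) (c q.1), add_comm (c (q.2.1, q.1.2))]
  have sw : ∀ f : (E × E) × (E × E) → ℝ≥0∞, Measurable f →
      ∫⁻ q in S, f q.swap ∂(π.prod π) = ∫⁻ q in S, f q ∂(π.prod π) := by
    intro f hf
    conv_lhs => rw [← hSswap]
    exact hswap.setLIntegral_comp_preimage hS hf
  let Φ : (E × E) × (E × E) → E × E := fun q => (q.1.1, if q ∈ S then q.2.2 else q.1.2)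
  have hΦ : Measurable Φ := by
    refine Measurable.prodMk (by fun_prop) (Measurable.ite hS (by fun_prop) (by fun_prop))
  have hlin : ∀ f : E × E → ℝ≥0∞, Measurable f → ∫⁻ p, f p ∂((π.prod π).map Φ) =
      ∫⁻ q in S, f (q.1.1, q.2.2) ∂(π.prod π) + ∫⁻ q in Sᶜ, f q.1 ∂(π.prod π) := by
    intro f hf
    rw [lintegral_map hf hΦ, ← lintegral_add_compl _ hS]
    congr 1
    · refine setLIntegral_congr_fun hS fun q hq => ?_
      simp [Φ, hq]
    · refine setLIntegral_congr_fun hS.compl fun q hq => ?_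
      have : q ∉ S := hq
      simp [Φ, this]
  have hlin0 : ∀ f : E × E → ℝ≥0∞, Measurable f → ∫⁻ p, f p ∂π =
      ∫⁻ q in S, f q.1 ∂(π.prod π) + ∫⁻ q in Sᶜ, f q.1 ∂(π.prod π) := by
    intro f hf
    rw [lintegral_add_compl _ hS]
    have : π = (π.prod π).map Prod.fst := by simp
    conv_lhs => rw [this]
    rw [lintegral_map hf measurable_fst]
  have m1 : ((π.prod π).map Φ).map Prod.fst = π.map Prod.fst := by
    have : π = (π.prod π).map Prod.fst := by simp
    conv_rhs => rw [this]
    rw [Measure.map_map measurable_fst hΦ, Measure.map_map measurable_fst measurable_fst]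
    rfl
  have m2 : ((π.prod π).map Φ).map Prod.snd = π.map Prod.snd := by
    refine Measure.ext_of_lintegral _ fun f hf => ?_
    rw [lintegral_map hf measurable_snd, lintegral_map hf measurable_snd,
      hlin _ (by fun_prop), hlin0 _ (by fun_prop)]
    congr 1
    exact sw (fun q => f q.1.2) (by fun_prop)
  have key := hopt _ m1 m2
  rw [hlin c hc, hlin0 c hc] at key
  rw [hlin0 c hc] at hfin
  have key2 := (ENNReal.add_le_add_iff_right (ne_top_of_le_ne_top hfin le_add_self)).1 key
  have hfin1 : ∫⁻ q in S, c q.1 ∂(π.prod π) ≠ ∞ := ne_top_of_le_ne_top hfin le_self_add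
  by_contra hne
  have s1 := sw (fun q => c q.1) (by fun_prop)
  have s2 := sw (fun q => c (q.1.1, q.2.2)) (by fun_prop)
  simp only [Prod.fst_swap, Prod.snd_swap] at s1 s2
  have hcross : ∫⁻ q in S, (c (q.1.1, q.2.2) + c (q.2.1, q.1.2)) ∂(π.prod π)
      = ∫⁻ q in S, c (q.1.1, q.2.2) ∂(π.prod π) + ∫⁻ q in S, c (q.1.1, q.2.2) ∂(π.prod π) := by
    rw [lintegral_add_left (by fun_prop), s2]
  have hdiag : ∫⁻ q in S, (c q.1 + c q.2) ∂(π.prod π)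
      = ∫⁻ q in S, c q.1 ∂(π.prod π) + ∫⁻ q in S, c q.1 ∂(π.prod π) := by
    rw [lintegral_add_left (by fun_prop), s1]
  have hle : ∫⁻ q in S, (c (q.1.1, q.2.2) + c (q.2.1, q.1.2)) ∂(π.prod π) ≤
      ∫⁻ q in S, (c q.1 + c q.2) ∂(π.prod π) :=
    setLIntegral_mono (by fun_prop) fun q hq => le_of_lt hq
  have hlt := setLIntegral_strict_mono (μ := π.prod π) hS hne
    (f := fun q => c (q.1.1, q.2.2) + c (q.2.1, q.1.2)) (g := fun q => c q.1 + c q.2)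
    (by fun_prop)
    (ne_top_of_le_ne_top (by rw [hdiag]; exact ENNReal.add_ne_top.2 ⟨hfin1, hfin1⟩) hle)
    (ae_of_all _ fun q hq => hq)
  rw [hcross, hdiag] at hlt
  exact absurd (add_le_add key2 key2) (not_le.2 hlt)

lemma two_mono_supp {E : Type*} [TopologicalSpace E] [SecondCountableTopology E]
    [MeasurableSpace E] [BorelSpace E] (π : Measure (E × E)) [IsProbabilityMeasure π]
    (c : E × E → ℝ) (hc : Continuous c) (hc0 : ∀ p, 0 ≤ c p)
    (hfin : ∫⁻ p, ENNReal.ofReal (c p) ∂π ≠ ∞)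
    (hopt : ∀ π' : Measure (E × E), π'.map Prod.fst = π.map Prod.fst →
      π'.map Prod.snd = π.map Prod.snd →
      ∫⁻ p, ENNReal.ofReal (c p) ∂π ≤ ∫⁻ p, ENNReal.ofReal (c p) ∂π')
    {x y x' y' : E} (h : (x, y) ∈ π.support) (h' : (x', y') ∈ π.support) :
    c (x, y) + c (x', y') ≤ c (x, y') + c (x', y) := by
  have key := two_mono_ae π (fun p => ENNReal.ofReal (c p)) (by fun_prop) hfin hopt
  by_contra! hlt
  have hopen : IsOpen {q : (E × E) × (E × E) | c (q.1.1, q.2.2) + c (q.2.1, q.1.2) < c q.1 + c q.2} :=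
    isOpen_lt (by fun_prop) (by fun_prop)
  have hmem := hopen.mem_nhds (x := ((x, y), (x', y'))) hlt
  rw [nhds_prod_eq, Filter.mem_prod_iff] at hmem
  obtain ⟨U, hU, V, hV, hUV⟩ := hmem
  have pU := (Measure.mem_support_iff_forall _).1 h U hU
  have pV := (Measure.mem_support_iff_forall _).1 h' V hV
  have : (π.prod π) (U ×ˢ V) = 0 := by
    refine measure_mono_null (fun q hq => ?_) key
    have := hUV hq
    simp only [mem_ofPred_eq] at this ⊢
    rw [← ENNReal.ofReal_add (hc0 _) (hc0 _), ← ENNReal.ofReal_add (hc0 _) (hc0 _)]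
    exact (ENNReal.ofReal_lt_ofReal_iff_of_nonneg (add_nonneg (hc0 _) (hc0 _))).2 this
  rw [Measure.prod_prod] at this
  exact (mul_ne_zero pU.ne' pV.ne') this

end TwoMono

section Convexity

open scoped RealInnerProductSpace

variable {E : Type*} [NormedAddCommGroup E] [InnerProductSpace ℝ E]

/-- gradient of `‖z‖ ^ ρ / ρ` -/
def gradP (ρ : ℝ) (z : E) : E := (‖z‖ ^ (ρ - 2)) • z

lemma continuous_gradP {ρ : ℝ} (hρ : 1 < ρ) : Continuous (gradP ρ : E → E) := by
  rw [continuous_iff_continuousAt]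
  intro z
  by_cases hz : z = 0
  · subst hz
    have h0 : gradP ρ (0 : E) = 0 := by simp [gradP]
    rw [ContinuousAt, h0, tendsto_zero_iff_norm_tendsto_zero]
    have hn : ∀ w : E, ‖gradP ρ w‖ = ‖w‖ ^ (ρ - 1) := by
      intro w
      rw [gradP, norm_smul, Real.norm_of_nonneg (by positivity)]
      by_cases hw : w = 0
      · subst hw
        rw [norm_zero, mul_zero, Real.zero_rpow (by linarith)]
      · rw [← Real.rpow_add_one (norm_ne_zero_iff.2 hw)]
        ring_nf
    have hc : Continuous fun w : E => ‖w‖ ^ (ρ - 1) :=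
      continuous_norm.rpow_const fun _ => Or.inr (by linarith)
    have := hc.tendsto 0
    rw [norm_zero, Real.zero_rpow (by linarith)] at this
    exact this.congr fun w => (hn w).symm
  · unfold gradP
    exact ((continuous_norm.continuousAt).rpow_const (Or.inl (norm_ne_zero_iff.2 hz))).smul
      continuousAt_id

lemma grad_strict {ρ : ℝ} (hρ : 1 < ρ) {z w : E} (h : w ≠ z) :
    ‖z‖ ^ ρ + ρ * ⟪gradP ρ z, w - z⟫ < ‖w‖ ^ ρ := by
  by_cases hz : z = 0
  · subst hz
    have : 0 < ‖w‖ := norm_pos_iff.2 h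
    have h2 : 0 < ‖w‖ ^ ρ := by positivity
    simpa [gradP, Real.zero_rpow (show ρ ≠ 0 by linarith)] using h2
  have hzp : 0 < ‖z‖ := norm_pos_iff.2 hz
  have e1 : ‖z‖ ^ (ρ - 2) * ‖z‖ ^ 2 = ‖z‖ ^ ρ := by
    rw [← Real.rpow_natCast, ← Real.rpow_add hzp]; congr 1; push_cast; ring
  have e2 : ‖z‖ ^ (ρ - 2) * ‖z‖ = ‖z‖ ^ (ρ - 1) := by
    rw [← Real.rpow_add_one hzp.ne']; congr 1; ring
  have e3 : ⟪gradP ρ z, w - z⟫ = ‖z‖ ^ (ρ - 2) * ⟪z, w⟫ - ‖z‖ ^ ρ := by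
    rw [gradP, real_inner_smul_left, inner_sub_right, real_inner_self_eq_norm_sq, mul_sub, e1]
  have hq : ρ.HolderConjugate (ρ / (ρ - 1)) := Real.HolderConjugate.conjExponent hρ
  have hw0 := norm_nonneg w
  have e4 : (‖z‖ ^ (ρ - 1)) ^ (ρ / (ρ - 1)) = ‖z‖ ^ ρ := by
    rw [← Real.rpow_mul hzp.le]; congr 1; field_simp [show ρ - 1 ≠ 0 by linarith]
  have young : ‖w‖ * ‖z‖ ^ (ρ - 1) ≤ ‖w‖ ^ ρ / ρ + ‖z‖ ^ ρ / (ρ / (ρ - 1)) := by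
    have := Real.young_inequality_of_nonneg hw0 (by positivity : 0 ≤ ‖z‖ ^ (ρ - 1)) hq
    rwa [e4] at this
  have ρp : 0 < ρ := by linarith
  have e5 : ρ * (‖w‖ ^ ρ / ρ + ‖z‖ ^ ρ / (ρ / (ρ - 1))) = ‖w‖ ^ ρ + (ρ - 1) * ‖z‖ ^ ρ := by
    field_simp
  have cs : ⟪z, w⟫ ≤ ‖z‖ * ‖w‖ := real_inner_le_norm z w
  have hpos : 0 < ‖z‖ ^ (ρ - 2) := by positivity
  rw [e3]
  have step1 : ‖z‖ ^ (ρ - 2) * ⟪z, w⟫ ≤ ‖w‖ * ‖z‖ ^ (ρ - 1) := by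
    calc _ ≤ ‖z‖ ^ (ρ - 2) * (‖z‖ * ‖w‖) := by gcongr
      _ = _ := by rw [← e2]; ring
  suffices ‖z‖ ^ (ρ - 2) * ⟪z, w⟫ < ‖w‖ ^ ρ / ρ + ‖z‖ ^ ρ / (ρ / (ρ - 1)) by
    have := mul_lt_mul_of_pos_left this ρp
    rw [e5] at this
    linarith
  by_cases hn : ‖w‖ = ‖z‖
  · refine lt_of_lt_of_le ?_ young
    have hd : 0 < ‖w - z‖ := norm_pos_iff.2 (sub_ne_zero.2 h)
    have hsq := norm_sub_sq_real w z
    rw [hn, real_inner_comm] at hsq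
    have : ⟪z, w⟫ < ‖z‖ * ‖w‖ := by rw [hn]; nlinarith [real_inner_comm w z]
    calc _ < ‖z‖ ^ (ρ - 2) * (‖z‖ * ‖w‖) := by gcongr
      _ = _ := by rw [← e2]; ring
  · refine lt_of_le_of_lt step1 (lt_of_le_of_ne young ?_)
    intro he
    have := (Real.young_inequality_eq_iff_of_nonneg hw0
      (by positivity : 0 ≤ ‖z‖ ^ (ρ - 1)) hq).1 (by rw [e4]; exact he)
    rw [e4] at this
    exact hn ((Real.rpow_left_inj hw0 hzp.le ρp.ne').1 this)

lemma grad_le {ρ : ℝ} (hρ : 1 < ρ) (z w : E) :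
    ‖z‖ ^ ρ + ρ * ⟪gradP ρ z, w - z⟫ ≤ ‖w‖ ^ ρ := by
  by_cases h : w = z
  · simp [h]
  · exact (grad_strict hρ h).le

lemma gradP_injective {ρ : ℝ} (hρ : 1 < ρ) : Function.Injective (gradP ρ : E → E) := by
  intro z w h
  by_contra hne
  have h1 := grad_strict hρ (Ne.symm hne)
  have h2 := grad_strict hρ hne
  rw [h] at h1
  have : ⟪gradP ρ w, w - z⟫ = - ⟪gradP ρ w, z - w⟫ := by
    rw [← inner_neg_right]; congr 1; abel
  rw [this] at h1
  linarith

lemma real_cross {ρ : ℝ} (hρ : 1 < ρ) {x x' y y' : ℝ} (hx : x < x') (hy : y' < y) :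
    |x - y'| ^ ρ + |x' - y| ^ ρ < |x - y| ^ ρ + |x' - y'| ^ ρ := by
  have g : ∀ a b : ℝ, b ≠ a → |a| ^ ρ + ρ * (gradP ρ a * (b - a)) < |b| ^ ρ := by
    intro a b hab
    have := grad_strict hρ hab
    simpa [mul_comm] using this
  have mono : ∀ a b : ℝ, a ≤ b → gradP ρ a ≤ gradP ρ b := by
    intro a b hab
    rcases hab.eq_or_lt with rfl | hlt
    · exact le_rfl
    have h1 := g a b hlt.ne'
    have h2 := g b a hlt.ne
    have h3 : 0 < ρ * ((gradP ρ b - gradP ρ a) * (b - a)) := by nlinarith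
    have h4 := (mul_pos_iff_of_pos_left (by linarith : 0 < ρ)).1 h3
    have h5 := (mul_pos_iff_of_pos_right (by linarith : 0 < b - a)).1 h4
    linarith
  rcases le_total (x - y') (x' - y) with h | h
  · have h1 := g (x - y') (x - y) (by intro h; linarith)
    have h2 := g (x' - y) (x' - y') (by intro h; linarith)
    have h3 := mul_nonneg (by linarith : 0 ≤ ρ)
      (mul_nonneg (sub_nonneg.2 (mono _ _ h)) (by linarith : 0 ≤ y - y'))
    nlinarith
  · have h1 := g (x' - y) (x - y) (by intro h; linarith)
    have h2 := g (x - y') (x' - y') (by intro h; linarith)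
    have h3 := mul_nonneg (by linarith : 0 ≤ ρ)
      (mul_nonneg (sub_nonneg.2 (mono _ _ h)) (by linarith : 0 ≤ x' - x))
    nlinarith

end Convexity

section Graph

open Filter Topology
open scoped RealInnerProductSpace Pointwise

variable {E : Type*} [NormedAddCommGroup E] [InnerProductSpace ℝ E] [FiniteDimensional ℝ E]
  [MeasurableSpace E] [BorelSpace E]

lemma ae_unique_volume {ρ : ℝ} (hρ : 1 < ρ) (Γ : Set (E × E))
    (hΓ : ∀ x y x' y', (x, y) ∈ Γ → (x', y') ∈ Γ →
      ‖x - y‖ ^ ρ + ‖x' - y'‖ ^ ρ ≤ ‖x - y'‖ ^ ρ + ‖x' - y‖ ^ ρ) :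
    ∀ᵐ x ∂(volume : Measure E), ∀ y₀ y₁, (x, y₀) ∈ Γ → (x, y₁) ∈ Γ → y₀ = y₁ := by
  let A : Set E → Set E := fun V => {x | ∃ y ∈ V, (x, y) ∈ Γ}
  have hd : ∀ᵐ x ∂(volume : Measure E), ∀ V ∈ TopologicalSpace.countableBasis E, x ∈ A V →
      Tendsto (fun r => volume (A V ∩ Metric.closedBall x r) / volume (Metric.closedBall x r))
        (𝓝[>] 0) (𝓝 1) := by
    rw [ae_ball_iff (TopologicalSpace.countable_countableBasis E)]
    intro V _
    exact ae_imp_of_ae_restrict (Besicovitch.ae_tendsto_measure_inter_div volume (A V))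
  filter_upwards [hd] with x hx y₀ y₁ h0 h1
  by_contra hne
  set v := gradP ρ (x - y₀) - gradP ρ (x - y₁) with hv
  have hv0 : v ≠ 0 := by
    intro h
    have := gradP_injective hρ (sub_eq_zero.1 h)
    exact hne (sub_right_injective this)
  have hcont : Continuous fun q : E × E × E =>
      ⟪gradP ρ (x - q.1) - gradP ρ (q.2.1 - y₁), q.2.2⟫ := by
    have := continuous_gradP (E := E) hρ
    fun_prop
  have hopen := (isOpen_lt continuous_const hcont : IsOpen {q : E × E × E |
    (0 : ℝ) < ⟪gradP ρ (x - q.1) - gradP ρ (q.2.1 - y₁), q.2.2⟫})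
  have hmem : {q : E × E × E |
    (0 : ℝ) < ⟪gradP ρ (x - q.1) - gradP ρ (q.2.1 - y₁), q.2.2⟫} ∈ 𝓝 (y₀, x, v) := by
    refine hopen.mem_nhds ?_
    show (0 : ℝ) < ⟪gradP ρ (x - y₀) - gradP ρ (x - y₁), v⟫
    rw [← hv]
    exact real_inner_self_pos.2 hv0
  rw [nhds_prod_eq, nhds_prod_eq, mem_prod_iff] at hmem
  obtain ⟨U, hU, W', hW', hsub⟩ := hmem
  rw [mem_prod_iff] at hW'
  obtain ⟨X, hX, T, hT, hsub'⟩ := hW'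
  obtain ⟨V, hV, hyV, hVU⟩ :=
    (TopologicalSpace.isBasis_countableBasis E).mem_nhds_iff.1 hU
  obtain ⟨δ, hδ, hδT⟩ := Metric.mem_nhds_iff.1 hT
  have hdens := hx V hV ⟨y₀, hyV, h0⟩
  have hne := Measure.eventually_nonempty_inter_smul_of_density_one volume (A V) x hdens
    (Metric.ball v δ) measurableSet_ball (Metric.measure_ball_pos _ _ hδ).ne'
  have hXr : ∀ᶠ r in 𝓝[>] (0 : ℝ), ∀ u ∈ Metric.ball v δ, x + r • u ∈ X := by
    obtain ⟨ε, hε, hεX⟩ := Metric.mem_nhds_iff.1 hX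
    have hpos : 0 < ‖v‖ + δ := by positivity
    filter_upwards [Ioo_mem_nhdsGT (show (0 : ℝ) < ε / (‖v‖ + δ) by positivity)] with r hr u hu
    apply hεX
    rw [Metric.mem_ball, dist_eq_norm, add_sub_cancel_left, norm_smul,
      Real.norm_of_nonneg hr.1.le]
    have hu' : ‖u‖ ≤ ‖v‖ + δ := by
      have := norm_le_norm_add_norm_sub v u
      rw [Metric.mem_ball, dist_eq_norm, norm_sub_rev] at hu
      linarith
    calc r * ‖u‖ ≤ r * (‖v‖ + δ) := by gcongr; exact hr.1.le
      _ < ε := (lt_div_iff₀ hpos).1 hr.2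
  obtain ⟨r, ⟨⟨x', hx'A, hx'⟩, hr2⟩, hr0⟩ :=
    ((hne.and hXr).and (self_mem_nhdsWithin)).exists
  have hr0 : 0 < r := hr0
  obtain ⟨y', hy'V, hy'Γ⟩ := hx'A
  obtain ⟨x0, hx0, _, ⟨u, hu, rfl⟩, rfl⟩ := hx'
  have hXu := hr2 u hu
  have hx0 : x0 = x := hx0
  simp only [hx0] at hy'Γ
  have hpos : (0 : ℝ) < ⟪gradP ρ (x - y') - gradP ρ ((x + r • u) - y₁), u⟫ :=
    hsub (show (y', x + r • u, u) ∈ U ×ˢ W' from ⟨hVU hy'V, hsub' ⟨hXu, hδT hu⟩⟩)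
  have hm := hΓ _ _ _ _ hy'Γ h1
  have g1 := grad_le hρ (x - y') (x + r • u - y')
  have g2 := grad_le hρ (x + r • u - y₁) (x - y₁)
  rw [show x + r • u - y' - (x - y') = r • u by abel, real_inner_smul_right] at g1
  rw [show x - y₁ - (x + r • u - y₁) = -(r • u) by abel, inner_neg_right,
    real_inner_smul_right] at g2
  rw [inner_sub_left] at hpos
  have : 0 < ρ * (r * (⟪gradP ρ (x - y'), u⟫ - ⟪gradP ρ (x + r • u - y₁), u⟫)) := by
    have : 0 < ρ := by linarith
    positivity
  nlinarith

lemma ae_unique_one {ρ : ℝ} (hρ : 1 < ρ)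
    (Γ : Set (EuclideanSpace ℝ (Fin 1) × EuclideanSpace ℝ (Fin 1)))
    (hΓ : ∀ x y x' y', (x, y) ∈ Γ → (x', y') ∈ Γ →
      ‖x - y‖ ^ ρ + ‖x' - y'‖ ^ ρ ≤ ‖x - y'‖ ^ ρ + ‖x' - y‖ ^ ρ)
    (η : Measure (EuclideanSpace ℝ (Fin 1))) (hη : ∀ x, η {x} = 0) :
    ∀ᵐ x ∂η, ∀ y₀ y₁, (x, y₀) ∈ Γ → (x, y₁) ∈ Γ → y₀ = y₁ := by
  have hnorm : ∀ x y : EuclideanSpace ℝ (Fin 1), ‖x - y‖ = |x 0 - y 0| := by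
    intro x y
    rw [EuclideanSpace.norm_eq]
    simp [Real.sqrt_sq_eq_abs]
  have hext : ∀ x y : EuclideanSpace ℝ (Fin 1), x 0 = y 0 → x = y := by
    intro x y h
    ext i
    rw [Subsingleton.elim i 0, h]
  have hmono : ∀ x y x' y', (x, y) ∈ Γ → (x', y') ∈ Γ → x 0 < x' 0 → y 0 ≤ y' 0 := by
    intro x y x' y' h h' hlt
    by_contra! hy
    have h1 := hΓ _ _ _ _ h h'
    simp only [hnorm] at h1
    exact absurd (real_cross hρ hlt hy) (not_lt.2 h1)
  let B : ℚ → Set (EuclideanSpace ℝ (Fin 1)) := fun q =>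
    {x | ∃ y₀ y₁, (x, y₀) ∈ Γ ∧ (x, y₁) ∈ Γ ∧ y₀ 0 < q ∧ (q : ℝ) < y₁ 0}
  have hB : ∀ q, (B q).Subsingleton := by
    rintro q x ⟨y₀, y₁, h0, h1, hq0, hq1⟩ x' ⟨z₀, z₁, k0, k1, kq0, kq1⟩
    apply hext
    by_contra hne
    rcases lt_or_gt_of_ne hne with h | h
    · have := hmono _ _ _ _ h1 k0 h
      linarith
    · have := hmono _ _ _ _ k1 h0 h
      linarith
  have hBn : ∀ q, η (B q) = 0 := by
    intro q
    rcases (hB q).eq_empty_or_singleton with h | ⟨x, h⟩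
    · rw [h]; simp
    · rw [h]; exact hη x
  have hall : ∀ᵐ x ∂η, ∀ q, x ∉ B q := ae_all_iff.2 fun q => measure_eq_zero_iff_ae_notMem.1 (hBn q)
  filter_upwards [hall] with x hx y₀ y₁ h0 h1
  apply hext
  by_contra hne
  rcases lt_or_gt_of_ne hne with h | h
  · obtain ⟨q, hq, hq'⟩ := exists_rat_btwn h
    exact hx q ⟨y₀, y₁, h0, h1, hq, hq'⟩
  · obtain ⟨q, hq, hq'⟩ := exists_rat_btwn h
    exact hx q ⟨y₁, y₀, h1, h0, hq, hq'⟩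

lemma snd_of_graph (Γ : Set (E × E)) (hcl : IsClosed Γ) (η : Measure E)
    (hu : ∀ᵐ x ∂η, ∀ y₀ y₁, (x, y₀) ∈ Γ → (x, y₁) ∈ Γ → y₀ = y₁)
    (π : Measure (E × E)) (hπ : π.map Prod.fst = η) (hπΓ : ∀ᵐ p ∂π, p ∈ Γ)
    (C : Set E) (hC : IsClosed C) :
    π.map Prod.snd C = η (Prod.fst '' (Γ ∩ Prod.snd ⁻¹' C)) := by
  have hmeas : MeasurableSet (Prod.fst '' (Γ ∩ Prod.snd ⁻¹' C)) := by
    have : IsSigmaCompact (Prod.fst '' (Γ ∩ Prod.snd ⁻¹' C)) :=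
      (isSigmaCompact_univ.of_isClosed_subset (hcl.inter (hC.preimage continuous_snd))
        (subset_univ _)).image continuous_fst
    obtain ⟨K, hK, hKe⟩ := this
    rw [← hKe]
    exact MeasurableSet.iUnion fun n => (hK n).measurableSet
  rw [← hπ, Measure.map_apply measurable_snd hC.measurableSet, Measure.map_apply measurable_fst hmeas]
  rw [← hπ] at hu
  have hu' := ae_of_ae_map measurable_fst.aemeasurable hu
  apply measure_congr
  filter_upwards [hu', hπΓ] with p hp hpΓ
  apply propext
  constructor
  · intro h
    exact ⟨p, ⟨hpΓ, h⟩, rfl⟩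
  · rintro ⟨q, ⟨hqΓ, hqC⟩, hqp⟩
    have : q.2 = p.2 := hp q.2 p.2 (by rw [← hqp]; exact hqΓ) hpΓ
    show p.2 ∈ C
    rw [← this]
    exact hqC

end Graph

section Final

variable {E : Type*} [NormedAddCommGroup E] [InnerProductSpace ℝ E] [FiniteDimensional ℝ E]
  [MeasurableSpace E] [BorelSpace E]

lemma Wp_le (ρ : ℝ) (μ ν : Measure E) (π : Measure (E × E)) (h1 : π.map Prod.fst = μ)
    (h2 : π.map Prod.snd = ν) : Wp ρ μ ν ≤ ∫⁻ p, ENNReal.ofReal (‖p.1 - p.2‖ ^ ρ) ∂π :=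
  iInf_le_of_le π (iInf_le_of_le h1 (iInf_le_of_le h2 le_rfl))

lemma continuous_cost {ρ : ℝ} (hρ : 1 < ρ) : Continuous fun p : E × E => ‖p.1 - p.2‖ ^ ρ :=
  (continuous_fst.sub continuous_snd).norm.rpow_const fun _ => Or.inr (by linarith)

lemma Wp_attained {ρ : ℝ} (hρ : 1 < ρ) (μ ν : Measure E) [IsProbabilityMeasure μ]
    [IsProbabilityMeasure ν] : ∃ π : Measure (E × E), π.map Prod.fst = μ ∧ π.map Prod.snd = ν ∧
      ∫⁻ p, ENNReal.ofReal (‖p.1 - p.2‖ ^ ρ) ∂π = Wp ρ μ ν := by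
  obtain ⟨π, h1, h2, h⟩ := exists_opt (fun p : E × E => ‖p.1 - p.2‖ ^ ρ) (continuous_cost hρ) μ ν
  exact ⟨π, h1, h2, le_antisymm (le_iInf fun π' => le_iInf fun h1' => le_iInf fun h2' => h π' h1' h2')
    (Wp_le ρ μ ν π h1 h2)⟩

lemma Wp_ne_top {ρ : ℝ} (hρ : 1 < ρ) (μ ν : Measure E) [IsProbabilityMeasure μ]
    [IsProbabilityMeasure ν] (hμ : Integrable (fun x => ‖x‖ ^ ρ) μ)
    (hν : Integrable (fun x => ‖x‖ ^ ρ) ν) : Wp ρ μ ν ≠ ∞ := by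
  refine ne_top_of_le_ne_top ?_ (Wp_le ρ μ ν (μ.prod ν) (by simp) (by simp))
  have hi : Integrable (fun p : E × E => 2 ^ ρ * (‖p.1‖ ^ ρ + ‖p.2‖ ^ ρ)) (μ.prod ν) :=
    ((hμ.comp_fst ν).add (hν.comp_snd μ)).const_mul _
  refine ne_top_of_le_ne_top hi.lintegral_lt_top.ne (lintegral_mono fun p => ?_)
  apply ENNReal.ofReal_le_ofReal
  have ρ0 : 0 ≤ ρ := by linarith
  have hle : ‖p.1 - p.2‖ ≤ 2 * max ‖p.1‖ ‖p.2‖ := by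
    have := norm_sub_le p.1 p.2
    have := le_max_left ‖p.1‖ ‖p.2‖
    have := le_max_right ‖p.1‖ ‖p.2‖
    linarith
  have hm : 0 ≤ max ‖p.1‖ ‖p.2‖ := le_max_of_le_left (norm_nonneg _)
  calc ‖p.1 - p.2‖ ^ ρ ≤ (2 * max ‖p.1‖ ‖p.2‖) ^ ρ := by gcongr
    _ = 2 ^ ρ * (max ‖p.1‖ ‖p.2‖) ^ ρ := Real.mul_rpow (by norm_num) hm
    _ ≤ _ := by
      gcongr
      have a1 : 0 ≤ ‖p.1‖ ^ ρ := by positivity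
      have a2 : 0 ≤ ‖p.2‖ ^ ρ := by positivity
      rcases max_choice ‖p.1‖ ‖p.2‖ with h | h <;> rw [h] <;> linarith

end Final

/-- for `ρ > 1` and `η, η₁, η₂ ∈ P_ρ(ℝ^d)`,
`W_ρ(η, (η₁+η₂)/2)^ρ ≤ (W_ρ(η,η₁)^ρ + W_ρ(η,η₂)^ρ)/2`; moreover, if `η` is absolutely
continuous with respect to the Lebesgue measure, or `d = 1` and `η` has no atom, equality
holds if and only if `η₁ = η₂`. -/
theorem stmt19 {d : ℕ} (ρ : ℝ) (hρ : 1 < ρ)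
    (η η₁ η₂ : Measure (EuclideanSpace ℝ (Fin d)))
    [IsProbabilityMeasure η] [IsProbabilityMeasure η₁] [IsProbabilityMeasure η₂]
    (hηρ : Integrable (fun x => ‖x‖ ^ ρ) η)
    (hη₁ρ : Integrable (fun x => ‖x‖ ^ ρ) η₁) (hη₂ρ : Integrable (fun x => ‖x‖ ^ ρ) η₂) :
    Wp ρ η ((2 : ℝ≥0∞)⁻¹ • η₁ + (2 : ℝ≥0∞)⁻¹ • η₂) ≤ (Wp ρ η η₁ + Wp ρ η η₂) / 2
    ∧ ((η ≪ (volume : Measure (EuclideanSpace ℝ (Fin d))) ∨ (d = 1 ∧ ∀ x, η {x} = 0)) →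
        (Wp ρ η ((2 : ℝ≥0∞)⁻¹ • η₁ + (2 : ℝ≥0∞)⁻¹ • η₂) = (Wp ρ η η₁ + Wp ρ η η₂) / 2
          ↔ η₁ = η₂)) := by
  obtain ⟨π₁, a1, b1, c1⟩ := Wp_attained hρ η η₁
  obtain ⟨π₂, a2, b2, c2⟩ := Wp_attained hρ η η₂
  have half : (2 : ℝ≥0∞)⁻¹ + (2 : ℝ≥0∞)⁻¹ = 1 := ENNReal.inv_two_add_inv_two
  set π := (2 : ℝ≥0∞)⁻¹ • π₁ + (2 : ℝ≥0∞)⁻¹ • π₂ with hπ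
  have hm1 : π.map Prod.fst = η := by
    rw [hπ, Measure.map_add _ _ measurable_fst, Measure.map_smul, Measure.map_smul, a1, a2,
      ← add_smul, half, one_smul]
  have hm2 : π.map Prod.snd = (2 : ℝ≥0∞)⁻¹ • η₁ + (2 : ℝ≥0∞)⁻¹ • η₂ := by
    rw [hπ, Measure.map_add _ _ measurable_snd, Measure.map_smul, Measure.map_smul, b1, b2]
  have hcost : ∫⁻ p, ENNReal.ofReal (‖p.1 - p.2‖ ^ ρ) ∂π = (Wp ρ η η₁ + Wp ρ η η₂) / 2 := by
    rw [hπ, lintegral_add_measure, lintegral_smul_measure, lintegral_smul_measure, c1, c2,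
      smul_eq_mul, smul_eq_mul, ← mul_add, div_eq_mul_inv, mul_comm]
  refine ⟨hcost ▸ Wp_le ρ _ _ π hm1 hm2, fun hη => ⟨fun heq => ?_, fun heq => ?_⟩⟩
  · have hprob : IsProbabilityMeasure π := by
      constructor
      have : π.map Prod.fst univ = 1 := by rw [hm1]; simp
      rwa [Measure.map_apply measurable_fst MeasurableSet.univ] at this
    have hfin : ∫⁻ p, ENNReal.ofReal (‖p.1 - p.2‖ ^ ρ) ∂π ≠ ∞ := by
      rw [hcost]
      exact ENNReal.div_ne_top (ENNReal.add_ne_top.2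
        ⟨Wp_ne_top hρ _ _ hηρ hη₁ρ, Wp_ne_top hρ _ _ hηρ hη₂ρ⟩) (by norm_num)
    have hmono : ∀ x y x' y', (x, y) ∈ π.support → (x', y') ∈ π.support →
        ‖x - y‖ ^ ρ + ‖x' - y'‖ ^ ρ ≤ ‖x - y'‖ ^ ρ + ‖x' - y‖ ^ ρ := by
      intro x y x' y' h h'
      refine two_mono_supp π (fun p => ‖p.1 - p.2‖ ^ ρ) (continuous_cost hρ)
        (fun p => by positivity) hfin (fun π' e1 e2 => ?_) h h'
      rw [hcost, ← heq]
      exact Wp_le ρ _ _ π' (e1.trans hm1) (e2.trans hm2)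
    have huniq : ∀ᵐ x ∂η, ∀ y₀ y₁, (x, y₀) ∈ π.support → (x, y₁) ∈ π.support → y₀ = y₁ := by
      rcases hη with hac | ⟨rfl, hat⟩
      · exact hac.ae_le (ae_unique_volume hρ _ hmono)
      · exact ae_unique_one hρ _ hmono η hat
    have hsupp : ∀ᵐ p ∂π, p ∈ π.support := Measure.support_mem_ae
    have ac1 : π₁ ≪ π := by
      intro s hs
      have : (2 : ℝ≥0∞)⁻¹ * π₁ s + (2 : ℝ≥0∞)⁻¹ * π₂ s = 0 := by simpa [hπ] using hs
      simpa using (add_eq_zero.1 this).1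
    have ac2 : π₂ ≪ π := by
      intro s hs
      have : (2 : ℝ≥0∞)⁻¹ * π₁ s + (2 : ℝ≥0∞)⁻¹ * π₂ s = 0 := by simpa [hπ] using hs
      simpa using (add_eq_zero.1 this).2
    refine ext_of_generate_finite _ ?_ isPiSystem_isClosed (fun C hC => ?_) (by simp)
    · rw [BorelSpace.measurable_eq (α := EuclideanSpace ℝ (Fin d)), borel_eq_generateFrom_isClosed]
    · rw [← b1, ← b2, snd_of_graph _ Measure.isClosed_support η huniq π₁ a1 (ac1.ae_le hsupp) C hC,
        snd_of_graph _ Measure.isClosed_support η huniq π₂ a2 (ac2.ae_le hsupp) C hC]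
  · subst heq
    rw [← add_smul, half, one_smul, ENNReal.add_div, ENNReal.add_halves]
end
end
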